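/- arXiv:2303.02793 — 3 statements merged into one kernel-verified Lean document; each statement's English description precedes it below -/
import Mathlib

section
/- The sequence a is D-finite: there exist an integer r ≥ 1 and polynomials p0, …, pr ∈ ℤ[x], not all zero, such that p0(n)·a(n) + p1(n)·a(n+1) + ⋯ + pr(n)·a(n+r) = 0 for all integers n ≥ 1. -/
/-- `a172572 n` is the number of `3n × 6` matrices with entries in `{0,1}` such
that every row sum equals `2` and every column sum equals `n` (OEIS A172572). -/
noncomputable def a172572 (n : ℕ) : ℕ :=
  Nat.card {M : Fin (3 * n) → Fin 6 → Fin 2 //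
    (∀ i : Fin (3 * n), ∑ j : Fin 6, ((M i j : ℕ)) = 2) ∧
    (∀ j : Fin 6, ∑ i : Fin (3 * n), ((M i j : ℕ)) = n)}

namespace LaurentConstantTerm

variable {σ : Type*}

/-- Laurent polynomials over `ℤ` in the variables `σ`. -/
abbrev Laurent (σ : Type*) : Type _ := AddMonoidAlgebra ℤ (σ → ℤ)

open AddMonoidAlgebra (single)

section Derivatives

variable [Fintype σ]

/-- The coefficient `∏ᵢ kᵢ (kᵢ - 1) ⋯ (kᵢ - γᵢ + 1)` with which `∂^γ` acts on `x^k`. -/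
def fallingFactor (k : σ → ℤ) (γ : σ → ℕ) : ℤ :=
  ∏ i, ∏ s ∈ Finset.range (γ i), (k i - s)

/-- The differential operator `∂^γ` on Laurent polynomials. -/
noncomputable def iterDeriv (γ : σ → ℕ) : Laurent σ →ₗ[ℤ] Laurent σ :=
  (Finsupp.lsum ℤ fun k => fallingFactor k γ •
    AddMonoidAlgebra.lsingle (R := ℤ) (S := ℤ) (k - fun i => (γ i : ℤ))) ∘ₗ
  AddMonoidAlgebra.coeffAddEquiv.toIntLinearEquiv.toLinearMap

omit [Fintype σ] in
theorem linearMap_congr_single {M : Type*} [AddCommGroup M] {f g : Laurent σ →ₗ[ℤ] M}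
    (h : ∀ k c, f (single k c) = g (single k c)) : f = g := by
  refine LinearMap.ext fun x => ?_
  induction x using AddMonoidAlgebra.induction_linear with
  | zero => simp
  | add x y hx hy => simp [hx, hy]
  | single k c => exact h k c

theorem iterDeriv_single (γ : σ → ℕ) (k : σ → ℤ) (c : ℤ) :
    iterDeriv γ (single k c) = single (k - fun i => (γ i : ℤ)) (fallingFactor k γ * c) := by
  simp [iterDeriv, -zsmul_eq_mul]

theorem iterDeriv_zero (x : Laurent σ) : iterDeriv 0 x = x := by
  suffices h : iterDeriv (0 : σ → ℕ) = LinearMap.id by rw [h]; rfl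
  refine linearMap_congr_single fun k c => ?_
  rw [iterDeriv_single]
  congr 1
  · ext; simp
  · simp [fallingFactor]

theorem coeff_iterDeriv (γ : σ → ℕ) (x : Laurent σ) (κ : σ → ℤ) :
    (iterDeriv γ x).coeff κ =
      fallingFactor (κ + fun i => (γ i : ℤ)) γ * x.coeff (κ + fun i => (γ i : ℤ)) := by
  classical
  induction x using AddMonoidAlgebra.induction_linear with
  | zero => simp
  | add x y hx hy => simp [hx, hy, mul_add]
  | single k c =>
    simp only [iterDeriv_single, AddMonoidAlgebra.coeff_single, Finsupp.single_apply,
      sub_eq_iff_eq_add]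
    split_ifs with h
    · rw [h]
    · simp

variable [DecidableEq σ]

/-- The partial derivative `∂ᵢ` on Laurent polynomials. -/
noncomputable def partialDeriv (i : σ) : Laurent σ →ₗ[ℤ] Laurent σ := iterDeriv (Pi.single i 1)

theorem partialDeriv_single (i : σ) (k : σ → ℤ) (c : ℤ) :
    partialDeriv i (single k c) = single (k - Pi.single i 1) (k i * c) := by
  rw [partialDeriv, iterDeriv_single]
  congr 1
  · ext j
    by_cases h : j = i
    · subst h; simp
    · simp [h]
  · congr 1
    rw [fallingFactor, Finset.prod_eq_single i]
    · simp
    · intro j _ hj; simp [hj]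
    · simp

theorem partialDeriv_iterDeriv (i : σ) (γ : σ → ℕ) (x : Laurent σ) :
    partialDeriv i (iterDeriv γ x) = iterDeriv (γ + Pi.single i 1) x := by
  suffices h : partialDeriv i ∘ₗ iterDeriv γ = iterDeriv (γ + Pi.single i 1) from
    DFunLike.congr_fun h x
  refine linearMap_congr_single fun k c => ?_
  rw [LinearMap.comp_apply, iterDeriv_single, partialDeriv_single, iterDeriv_single, ← mul_assoc]
  congr 1
  · ext j
    by_cases h : j = i
    · subst h; simp; ring
    · simp [h]
  · congr 1
    rw [fallingFactor, fallingFactor, ← Finset.mul_prod_erase _ _ (Finset.mem_univ i),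
      ← Finset.mul_prod_erase _ _ (Finset.mem_univ i), ← mul_assoc]
    congr 1
    · simp [Finset.prod_range_succ, mul_comm]
    · refine Finset.prod_congr rfl fun j hj => ?_
      simp [Finset.ne_of_mem_erase hj]

theorem partialDeriv_mul (i : σ) (x y : Laurent σ) :
    partialDeriv i (x * y) = partialDeriv i x * y + x * partialDeriv i y := by
  induction x using AddMonoidAlgebra.induction_linear with
  | zero => simp
  | add x z hx hz => simp only [add_mul, map_add, hx, hz]; abel
  | single k c =>
    induction y using AddMonoidAlgebra.induction_linear with
    | zero => simp
    | add x z hx hz => simp only [mul_add, map_add, hx, hz]; abel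
    | single l d =>
      simp only [AddMonoidAlgebra.single_mul_single, partialDeriv_single]
      rw [show k - Pi.single i 1 + l = k + l - Pi.single i 1 by abel,
        show k + (l - Pi.single i 1) = k + l - Pi.single i 1 by abel,
        ← AddMonoidAlgebra.single_add]
      congr 1
      simp only [Pi.add_apply]
      ring

theorem mul_partialDeriv_pow (i : σ) (x : Laurent σ) (n : ℕ) :
    x * partialDeriv i (x ^ n) = n * (partialDeriv i x * x ^ n) := by
  induction n with
  | zero =>
    have : partialDeriv i (1 : Laurent σ) = 0 := by
      have h := partialDeriv_mul i (1 : Laurent σ) 1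
      simpa using h
    simp [this]
  | succ n ih =>
    rw [pow_succ, partialDeriv_mul, mul_add, ← mul_assoc, ih]
    push_cast
    ring

end Derivatives

/-! ### A filtration on sequences of Laurent polynomials -/

/-- The sequence `n ↦ n ^ m * x ^ κ`. -/
noncomputable def monomialSeq (m : ℕ) (κ : σ → ℤ) : ℕ → Laurent σ :=
  fun n => single κ ((n : ℤ) ^ m)

/-- The sequences of Laurent polynomials that are polynomial in the index, of degree at most `d`,
and whose exponents have absolute value at most `d`. -/
noncomputable def boxSpan (σ : Type*) (d : ℕ) : Submodule ℤ (ℕ → Laurent σ) :=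
  Submodule.span ℤ {f | ∃ m ≤ d, ∃ κ : σ → ℤ, (∀ i, |κ i| ≤ d) ∧ f = monomialSeq m κ}

theorem monomialSeq_mem_boxSpan {d m : ℕ} {κ : σ → ℤ} (hm : m ≤ d) (hκ : ∀ i, |κ i| ≤ d) :
    monomialSeq m κ ∈ boxSpan σ d :=
  Submodule.subset_span ⟨m, hm, κ, hκ, rfl⟩

theorem boxSpan_le {d : ℕ} {S : Submodule ℤ (ℕ → Laurent σ)}
    (h : ∀ m ≤ d, ∀ κ : σ → ℤ, (∀ i, |κ i| ≤ d) → monomialSeq m κ ∈ S) : boxSpan σ d ≤ S := by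
  refine Submodule.span_le.2 ?_
  rintro _ ⟨m, hm, κ, hκ, rfl⟩
  exact h m hm κ hκ

theorem boxSpan_mono {d e : ℕ} (h : d ≤ e) : boxSpan σ d ≤ boxSpan σ e :=
  boxSpan_le fun _ hm _ hκ =>
    monomialSeq_mem_boxSpan (hm.trans h) fun i => (hκ i).trans (by exact_mod_cast h)

theorem monomialSeq_mul (m m' : ℕ) (κ κ' : σ → ℤ) :
    monomialSeq m κ * monomialSeq m' κ' = monomialSeq (m + m') (κ + κ') := by
  ext1 n
  simp [monomialSeq, AddMonoidAlgebra.single_mul_single, pow_add]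

theorem mul_mem_boxSpan {d e : ℕ} {f g : ℕ → Laurent σ} (hf : f ∈ boxSpan σ d)
    (hg : g ∈ boxSpan σ e) : f * g ∈ boxSpan σ (d + e) := by
  have key : boxSpan σ d * boxSpan σ e ≤ boxSpan σ (d + e) := by
    rw [boxSpan, boxSpan, Submodule.span_mul_span, Submodule.span_le]
    rintro _ ⟨_, ⟨m, hm, κ, hκ, rfl⟩, _, ⟨m', hm', κ', hκ', rfl⟩, rfl⟩
    simp only [monomialSeq_mul]
    refine monomialSeq_mem_boxSpan (add_le_add hm hm') fun i => ?_
    push_cast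
    exact (abs_add_le _ _).trans (add_le_add (hκ i) (hκ' i))
  exact key (Submodule.mul_mem_mul hf hg)

theorem one_mem_boxSpan : (1 : ℕ → Laurent σ) ∈ boxSpan σ 0 := by
  have : (1 : ℕ → Laurent σ) = monomialSeq 0 0 := by
    ext1 n; simp [monomialSeq, AddMonoidAlgebra.one_def]
  rw [this]
  exact monomialSeq_mem_boxSpan le_rfl (by simp)

theorem pow_mem_boxSpan {d : ℕ} {f : ℕ → Laurent σ} (hf : f ∈ boxSpan σ d) (n : ℕ) :
    f ^ n ∈ boxSpan σ (n * d) := by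
  induction n with
  | zero => simpa using one_mem_boxSpan
  | succ n ih =>
    rw [pow_succ, add_mul, one_mul]
    exact mul_mem_boxSpan ih hf

theorem index_mem_boxSpan : (fun n : ℕ => (n : Laurent σ)) ∈ boxSpan σ 1 := by
  have : (fun n : ℕ => (n : Laurent σ)) = monomialSeq 1 0 := by
    ext1 n; simp [monomialSeq, AddMonoidAlgebra.natCast_def]
  rw [this]
  exact monomialSeq_mem_boxSpan le_rfl (by simp)

theorem shift_mem_boxSpan {d : ℕ} {f : ℕ → Laurent σ} (hf : f ∈ boxSpan σ d) (j : ℕ) :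
    (fun n => f (n + j)) ∈ boxSpan σ d := by
  suffices h : boxSpan σ d ≤
      (boxSpan σ d).comap (LinearMap.funLeft ℤ (Laurent σ) (fun n => n + j)) from h hf
  refine boxSpan_le fun m hm κ hκ => ?_
  have : LinearMap.funLeft ℤ (Laurent σ) (fun n => n + j) (monomialSeq m κ) =
      ∑ a ∈ Finset.range (m + 1), ((j : ℤ) ^ (m - a) * (m.choose a : ℤ)) • monomialSeq a κ := by
    ext1 n
    simp only [LinearMap.funLeft_apply, monomialSeq, Finset.sum_apply, Pi.smul_apply,
      AddMonoidAlgebra.smul_single, Nat.cast_add, add_pow, smul_eq_mul]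
    rw [← AddMonoidAlgebra.lsingle_apply (R := ℤ), map_sum]
    refine Finset.sum_congr rfl fun a _ => ?_
    rw [AddMonoidAlgebra.lsingle_apply]
    congr 1
    ring
  rw [Submodule.mem_comap, this]
  refine Submodule.sum_mem _ fun a ha => Submodule.smul_mem _ _ ?_
  exact monomialSeq_mem_boxSpan (by have := Finset.mem_range.1 ha; omega) hκ

theorem partialDeriv_mem_boxSpan [Fintype σ] [DecidableEq σ] {d : ℕ} {f : ℕ → Laurent σ}
    (hf : f ∈ boxSpan σ d) (i : σ) :
    (fun n => partialDeriv i (f n)) ∈ boxSpan σ (d + 1) := by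
  suffices h : boxSpan σ d ≤ (boxSpan σ (d + 1)).comap ((partialDeriv i).compLeft ℕ) from h hf
  refine boxSpan_le fun m hm κ hκ => ?_
  have : (partialDeriv i).compLeft ℕ (monomialSeq m κ) =
      κ i • monomialSeq m (κ - Pi.single i 1) := by
    ext1 n
    simp [monomialSeq, partialDeriv_single]
  rw [Submodule.mem_comap, this]
  refine Submodule.smul_mem _ _ (monomialSeq_mem_boxSpan (by omega) fun j => ?_)
  rw [Pi.sub_apply]
  refine (abs_sub _ _).trans ?_
  push_cast
  refine add_le_add (hκ j) ?_
  by_cases h : j = i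
  · subst h; simp
  · simp [h]

theorem exists_const_mem_boxSpan [Fintype σ] (P : Laurent σ) :
    ∃ d, (fun _ => P) ∈ boxSpan σ d := by
  induction P using AddMonoidAlgebra.induction_linear with
  | zero => exact ⟨0, Submodule.zero_mem _⟩
  | add x y hx hy =>
    obtain ⟨d, hd⟩ := hx
    obtain ⟨e, he⟩ := hy
    exact ⟨max d e, Submodule.add_mem _ (boxSpan_mono (le_max_left _ _) hd)
      (boxSpan_mono (le_max_right _ _) he)⟩
  | single k c =>
    refine ⟨∑ i, (k i).natAbs, ?_⟩
    have : (fun _ : ℕ => (single k c : Laurent σ)) = c • monomialSeq 0 k := by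
      ext1 n; simp [monomialSeq]
    rw [this]
    refine Submodule.smul_mem _ _ (monomialSeq_mem_boxSpan (Nat.zero_le _) fun i => ?_)
    rw [Int.abs_eq_natAbs]
    exact_mod_cast Finset.single_le_sum (f := fun i => (k i).natAbs) (fun _ _ => Nat.zero_le _)
      (Finset.mem_univ i)

/-- A family in `boxSpan σ d` with more than `(d + 1) (2 d + 1) ^ |σ|` members is dependent. -/
theorem exists_relation_of_card_lt [Fintype σ] {ι : Type*} [Fintype ι] {d : ℕ}
    {v : ι → ℕ → Laurent σ} (hv : ∀ a, v a ∈ boxSpan σ d)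
    (hcard : (d + 1) * (2 * d + 1) ^ Fintype.card σ < Fintype.card ι) :
    ∃ c : ι → ℤ, ∑ a, c a • v a = 0 ∧ ∃ a, c a ≠ 0 := by
  classical
  rw [← Fintype.not_linearIndependent_iff]
  intro hli
  let g : Fin (d + 1) × (σ → Finset.Icc (-(d : ℤ)) d) → ℕ → Laurent σ :=
    fun q => monomialSeq q.1 fun i => q.2 i
  have hle : boxSpan σ d ≤ Submodule.span ℤ (Set.range g) := by
    refine boxSpan_le fun m hm κ hκ => Submodule.subset_span ?_
    exact ⟨(⟨m, Nat.lt_succ_of_le hm⟩, fun i => ⟨κ i, Finset.mem_Icc.2 (abs_le.1 (hκ i))⟩), rfl⟩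
  have h1 := linearIndependent_le_span' v hli (Set.range g)
    (by rintro _ ⟨a, rfl⟩; exact hle (hv a))
  rw [Cardinal.mk_fintype, Nat.cast_le] at h1
  have h2 := h1.trans (Fintype.card_range_le g)
  have h3 : ((d : ℤ) + 1 + d).toNat = 2 * d + 1 := by omega
  simp [h3] at h2
  omega

/-! ### The recurrence -/

section Recurrence

variable [Fintype σ]

/-- The inverse `∏ᵢ xᵢ⁻¹` of the product of the variables. -/
noncomputable def invProd (σ : Type*) : Laurent σ := single (fun _ => -1) 1

theorem exists_numerator {P : Laurent σ} {b : ℕ} (hb : (fun _ => P) ∈ boxSpan σ b) (s : ℕ)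
    (γ : σ → ℕ) (hγ : ∑ i, γ i = s) :
    ∃ Q ∈ boxSpan σ ((b + 2) * s + 1), ∀ n : ℕ,
      P ^ s * iterDeriv γ (P ^ n * invProd σ) = P ^ n * Q n := by
  classical
  induction s generalizing γ with
  | zero =>
    obtain rfl : γ = 0 := by
      ext i
      exact (Finset.sum_eq_zero_iff.1 hγ) i (Finset.mem_univ i)
    refine ⟨monomialSeq 0 fun _ => -1, monomialSeq_mem_boxSpan (Nat.zero_le _) (by simp), ?_⟩
    intro n
    simp [iterDeriv_zero, monomialSeq, invProd]
  | succ s ih =>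
    obtain ⟨i, -, hi⟩ : ∃ i ∈ Finset.univ, γ i ≠ 0 :=
      Finset.exists_ne_zero_of_sum_ne_zero (by omega)
    obtain ⟨γ', rfl⟩ : ∃ γ' : σ → ℕ, γ = γ' + Pi.single i 1 := by
      refine ⟨γ - Pi.single i 1, ?_⟩
      ext j
      by_cases h : j = i
      · subst h
        simp only [Pi.add_apply, Pi.sub_apply, Pi.single_eq_same]
        omega
      · simp [h]
    obtain ⟨Q, hQ, hPQ⟩ := ih γ' (by simpa [Finset.sum_add_distrib] using hγ)
    refine ⟨(fun n : ℕ => (n : Laurent σ)) * (fun _ => partialDeriv i P) * Q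
      + (fun _ => P) * (fun n => partialDeriv i (Q n))
      - (s : ℤ) • ((fun _ => partialDeriv i P) * Q), ?_, fun n => ?_⟩
    · have hP := partialDeriv_mem_boxSpan hb i
      refine Submodule.sub_mem _ (Submodule.add_mem _ ?_ ?_) (Submodule.smul_mem _ _ ?_)
      · exact boxSpan_mono (by ring_nf; omega)
          (mul_mem_boxSpan (mul_mem_boxSpan index_mem_boxSpan hP) hQ)
      · exact boxSpan_mono (by ring_nf; omega)
          (mul_mem_boxSpan hb (partialDeriv_mem_boxSpan hQ i))
      · exact boxSpan_mono (by ring_nf; omega) (mul_mem_boxSpan hP hQ)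
    · have h := congrArg (fun x => P * partialDeriv i x) (hPQ n)
      simp only [partialDeriv_mul, partialDeriv_iterDeriv, mul_add, ← mul_assoc,
        mul_partialDeriv_pow] at h
      simp only [Pi.add_apply, Pi.sub_apply, Pi.mul_apply, zsmul_eq_mul,
        Int.cast_natCast, Pi.natCast_apply]
      linear_combination h - s * partialDeriv i P * hPQ n

theorem fallingFactor_sub_one (γ δ : σ → ℕ) :
    fallingFactor ((fun i => -1 - (δ i : ℤ)) + fun i => (γ i : ℤ)) γ ≠ 0 ↔ γ ≤ δ := by
  simp only [fallingFactor, Finset.prod_ne_zero_iff, Pi.add_apply, Finset.mem_range, Pi.le_def,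
    Finset.mem_univ, true_implies]
  refine forall_congr' fun i => ⟨fun h => ?_, fun h s hs => by have := h; omega⟩
  by_contra! hlt
  exact h (γ i - 1 - δ i) (by omega) (by omega)

omit [Fintype σ] in
theorem coeff_mul_invProd (x : Laurent σ) :
    (x * invProd σ).coeff (fun _ => -1) = x.coeff 0 := by
  rw [invProd, AddMonoidAlgebra.coeff_mul_single_apply, mul_one, add_neg_cancel]

/-- The sequence of constant terms of the powers of a Laurent polynomial is D-finite. -/
theorem exists_recurrence_coeff_zero_pow (P : Laurent σ) :
    ∃ (r : ℕ) (p : ℕ → Polynomial ℤ), 1 ≤ r ∧ (∃ i, i ≤ r ∧ p i ≠ 0) ∧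
      ∀ n : ℕ, ∑ i ∈ Finset.range (r + 1),
        (p i).eval (n : ℤ) * (P ^ (n + i)).coeff 0 = 0 := by
  classical
  by_cases hP : P = 0
  · refine ⟨1, fun i => if i = 1 then 1 else 0, le_rfl, ⟨1, le_rfl, by simp⟩, fun n => ?_⟩
    simp [Finset.sum_range_succ, hP]
  obtain ⟨b, hb⟩ := exists_const_mem_boxSpan P
  obtain ⟨k, hk⟩ : ∃ k, k = Fintype.card σ := ⟨_, rfl⟩
  obtain ⟨C, hC⟩ : ∃ C, C = 1 + b * (k + 1) + (b + 2) * k + 1 := ⟨_, rfl⟩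
  obtain ⟨r, hr⟩ : ∃ r, r = (C + 1) * (2 * C + 1) ^ k := ⟨_, rfl⟩
  have hr1 : 1 ≤ r := hr ▸ Nat.one_le_iff_ne_zero.2 (by positivity)
  choose Q hQ hPQ using fun γ : σ → Fin (r + 1) =>
    exists_numerator hb _ (fun i => (γ i : ℕ)) rfl
  have hdeg (γ : σ → Fin (r + 1)) : ∑ i, (γ i : ℕ) ≤ k * (r + 1) := by
    refine (Finset.sum_le_card_nsmul _ _ (r + 1) fun i _ => (γ i).is_lt.le).trans ?_
    simp [hk]
  let v : Fin (r + 1) × Fin (r + 1) × (σ → Fin (r + 1)) → ℕ → Laurent σ := fun a =>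
    (fun n : ℕ => (n : Laurent σ)) ^ (a.1 : ℕ) *
      (fun _ => P) ^ (k * (r + 1) - ∑ i, (a.2.2 i : ℕ) + a.2.1) *
      (fun n => Q a.2.2 (n + a.2.1))
  have hv a : v a ∈ boxSpan σ (C * (r + 1)) := by
    obtain ⟨i, j, γ⟩ := a
    refine boxSpan_mono ?_ (mul_mem_boxSpan (mul_mem_boxSpan
      (pow_mem_boxSpan index_mem_boxSpan _) (pow_mem_boxSpan hb _)) (shift_mem_boxSpan (hQ γ) _))
    have h1 := hdeg γ
    have h2 : k * (r + 1) - ∑ i, (γ i : ℕ) + j ≤ (k + 1) * (r + 1) := by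
      have := j.is_lt
      rw [add_mul]
      omega
    calc (i : ℕ) * 1 + (k * (r + 1) - ∑ i, (γ i : ℕ) + j) * b + ((b + 2) * ∑ i, (γ i : ℕ) + 1)
        ≤ (r + 1) * 1 + (k + 1) * (r + 1) * b + ((b + 2) * (k * (r + 1)) + (r + 1)) := by
          gcongr
          · exact i.is_lt.le
          · omega
      _ = C * (r + 1) := by rw [hC]; ring
  have hvP (a : Fin (r + 1) × Fin (r + 1) × (σ → Fin (r + 1))) (n : ℕ) :
      P ^ n * v a n = P ^ (k * (r + 1)) * ((n : Laurent σ) ^ (a.1 : ℕ) *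
        iterDeriv (fun i => (a.2.2 i : ℕ)) (P ^ (n + a.2.1) * invProd σ)) := by
    obtain ⟨i, j, γ⟩ := a
    have h1 := hdeg γ
    have h2 := hPQ γ (n + j)
    simp only [v, Pi.mul_apply, Pi.pow_apply]
    rw [show P ^ (k * (r + 1)) = P ^ (k * (r + 1) - ∑ i, (γ i : ℕ)) * P ^ ∑ i, (γ i : ℕ) by
      rw [← pow_add, Nat.sub_add_cancel h1]]
    rw [pow_add P (k * (r + 1) - _)]
    rw [pow_add P n j] at h2 ⊢
    linear_combination (-1) * (n : Laurent σ) ^ (i : ℕ) * P ^ (k * (r + 1) - ∑ i, (γ i : ℕ)) * h2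
  obtain ⟨c, hc, ⟨i₀, j₀, γ₀⟩, hc₀⟩ := exists_relation_of_card_lt hv (by
    simp only [Fintype.card_prod, Fintype.card_fun, Fintype.card_fin, ← hk]
    calc (C * (r + 1) + 1) * (2 * (C * (r + 1)) + 1) ^ k
        ≤ ((C + 1) * (r + 1)) * ((2 * C + 1) * (r + 1)) ^ k := by
          gcongr
          · rw [add_mul]; omega
          · rw [add_mul, mul_assoc]; omega
      _ = r * ((r + 1) * (r + 1) ^ k) := by rw [mul_pow, hr]; ring
      _ < (r + 1) * ((r + 1) * (r + 1) ^ k) := by gcongr; omega)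
  have hrel (n : ℕ) : ∑ a, c a • ((n : Laurent σ) ^ (a.1 : ℕ) *
      iterDeriv (fun i => (a.2.2 i : ℕ)) (P ^ (n + a.2.1) * invProd σ)) = 0 := by
    refine (mul_eq_zero.1 (?_ : P ^ (k * (r + 1)) * _ = 0)).resolve_left (pow_ne_zero _ hP)
    rw [Finset.mul_sum]
    calc _ = P ^ n * (∑ a, c a • v a) n := by
          rw [Finset.sum_apply, Finset.mul_sum]
          refine Finset.sum_congr rfl fun a _ => ?_
          rw [mul_smul_comm, ← hvP, Pi.smul_apply, mul_smul_comm]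
      _ = 0 := by rw [hc]; simp
  obtain ⟨δ, ⟨⟨i₁, j₁, hδ⟩, hmin⟩⟩ := Set.Finite.exists_minimal
    (Set.toFinite {γ : σ → Fin (r + 1) | ∃ i j, c (i, j, γ) ≠ 0}) ⟨γ₀, i₀, j₀, hc₀⟩
  let q : Fin (r + 1) → Polynomial ℤ := fun j =>
    ∑ i : Fin (r + 1), Polynomial.monomial (i : ℕ) (c (i, j, δ))
  refine ⟨r, fun j => if h : j < r + 1 then q ⟨j, h⟩ else 0, hr1, ⟨j₁, by omega, ?_⟩, fun n => ?_⟩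
  · intro h
    have h' : (q j₁).coeff i₁ = 0 := by
      simpa only [dif_pos j₁.is_lt, Fin.eta, Polynomial.coeff_zero] using
        congrArg (fun f => f.coeff (i₁ : ℕ)) h
    refine hδ ?_
    simpa [q, Polynomial.finsetSum_coeff, Polynomial.coeff_monomial, Fin.val_inj] using h'
  · set κ : σ → ℤ := fun i => -1 - ((δ i : ℕ) : ℤ) with hκ
    let F (γ : σ → Fin (r + 1)) : ℤ := fallingFactor (κ + fun i => ((γ i : ℕ) : ℤ)) fun i => γ i
    have hF (γ : σ → Fin (r + 1)) : F γ ≠ 0 ↔ γ ≤ δ :=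
      fallingFactor_sub_one (fun i => (γ i : ℕ)) fun i => (δ i : ℕ)
    have hvanish i j γ (hγ : γ ≠ δ) : c (i, j, γ) * F γ = 0 := by
      by_contra! hne
      obtain ⟨hcγ, hFγ⟩ := mul_ne_zero_iff.1 hne
      have hle := (hF γ).1 hFγ
      exact hγ (le_antisymm hle (hmin ⟨i, j, hcγ⟩ hle))
    have h := congrArg (fun x => AddMonoidAlgebra.coeff x κ) (hrel n)
    have hsmul (m : ℕ) (x : Laurent σ) : (n : Laurent σ) ^ m * x = ((n : ℤ) ^ m) • x := by simp
    simp only [hsmul, AddMonoidAlgebra.coeff_sum, AddMonoidAlgebra.coeff_smul,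
      Finsupp.coe_finsetSum, Finset.sum_apply, Finsupp.coe_smul, Pi.smul_apply, smul_eq_mul,
      coeff_iterDeriv, AddMonoidAlgebra.coeff_zero, Finsupp.coe_zero, Pi.zero_apply,
      Fintype.sum_prod_type] at h
    refine (mul_eq_zero.1 (?_ : F δ * _ = 0)).resolve_left ((hF δ).2 le_rfl)
    rw [← h, Finset.sum_comm, Finset.sum_range, Finset.mul_sum]
    refine Finset.sum_congr rfl fun j _ => ?_
    simp only [dif_pos j.is_lt, Fin.eta, q, Polynomial.eval_finsetSum, Polynomial.eval_monomial,
      Finset.mul_sum, Finset.sum_mul]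
    refine Finset.sum_congr rfl fun i _ => ?_
    rw [Finset.sum_eq_single δ]
    · have hκδ : (κ + fun i => ((δ i : ℕ) : ℤ)) = fun _ => -1 := by ext; simp [hκ]
      simp only [F, hκδ, coeff_mul_invProd]
      ring
    · intro γ _ hγ
      linear_combination ((n : ℤ) ^ (i : ℕ) * (P ^ (n + (j : ℕ)) * invProd σ).coeff
        (κ + fun i => ((γ i : ℕ) : ℤ))) * hvanish i j γ hγ
    · simp

end Recurrence

end LaurentConstantTerm

open LaurentConstantTerm in
/-- The Laurent polynomial `e₂(x₁, …, x₆)³ / (x₁ ⋯ x₆)`. -/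
noncomputable def rowGeneratingLaurent : Laurent (Fin 6) :=
  (∑ ρ : Fin 6 → Fin 2 with ∑ j, (ρ j : ℕ) = 2,
    AddMonoidAlgebra.single (fun j => ((ρ j : ℕ) : ℤ)) 1) ^ 3 * invProd (Fin 6)

open LaurentConstantTerm in
theorem a172572_eq_coeff (n : ℕ) :
    (a172572 n : ℤ) = (rowGeneratingLaurent ^ n).coeff 0 := by
  have hprod (M : Fin (3 * n) → Fin 6 → Fin 2) :
      ∏ i, (AddMonoidAlgebra.single (fun j => ((M i j : ℕ) : ℤ)) 1 : Laurent (Fin 6)) =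
        AddMonoidAlgebra.single (fun j => ((∑ i, (M i j : ℕ) : ℕ) : ℤ)) 1 := by
    rw [AddMonoidAlgebra.prod_single]
    congr 1
    · ext; simp
    · simp
  have hinv : invProd (Fin 6) ^ n = AddMonoidAlgebra.single (fun _ => -(n : ℤ)) 1 := by
    rw [invProd, AddMonoidAlgebra.single_pow, one_pow]
    congr 1
    ext; simp
  rw [rowGeneratingLaurent, mul_pow, ← pow_mul, ← Fin.prod_const, Finset.prod_univ_sum, hinv,
    AddMonoidAlgebra.coeff_mul_single_apply, mul_one]
  simp only [hprod, AddMonoidAlgebra.coeff_sum, Finsupp.coe_finsetSum, Finset.sum_apply,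
    AddMonoidAlgebra.coeff_single, Finsupp.single_apply, Finset.sum_boole]
  rw [a172572, Nat.card_eq_fintype_card, Fintype.card_subtype, Nat.cast_inj]
  congr 1
  ext M
  simp only [Finset.mem_filter, Finset.mem_univ, true_and, Fintype.mem_piFinset, funext_iff,
    Pi.neg_apply, zero_add, neg_neg, Nat.cast_inj]

/-- The sequence `a172572` is D-finite: there are `r ≥ 1` and polynomials
`p₀, …, p_r ∈ ℤ[x]`, not all zero, with
`p₀(n)·a(n) + ⋯ + p_r(n)·a(n+r) = 0` for all `n ≥ 1`. -/
theorem stmt11 :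
    ∃ (r : ℕ) (p : ℕ → Polynomial ℤ), 1 ≤ r ∧ (∃ i, i ≤ r ∧ p i ≠ 0) ∧
      ∀ n : ℕ, 1 ≤ n →
        ∑ i ∈ Finset.range (r + 1), (p i).eval (n : ℤ) * (a172572 (n + i) : ℤ) = 0 := by
  obtain ⟨r, p, hr, hp, h⟩ := LaurentConstantTerm.exists_recurrence_coeff_zero_pow
    rowGeneratingLaurent
  refine ⟨r, p, hr, hp, fun n _ => ?_⟩
  simpa only [a172572_eq_coeff] using h n
end

section
/- There exist polynomials p0, …, p5 ∈ ℤ[x], each of degree at most 10 and with p5 ≠ 0, such that p0(n)·a(n) + p1(n)·a(n+1) + ⋯ + p5(n)·a(n+5) = 0 for all integers n ≥ 1. In particular, the sequence a is D-finite. -/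
/-- `a188818 n` is the number of `n × n` binary arrays without the pattern `01`
diagonally or antidiagonally: one never has `A(i,j) = 0` together with
`A(i+1,j+1) = 1`, and never `A(i,j) = 0` together with `A(i+1,j-1) = 1`
(OEIS A188818). -/
noncomputable def a188818 (n : ℕ) : ℕ :=
  Nat.card {A : Fin n × Fin n → Fin 2 //
    ∀ p q : Fin n × Fin n, (q.1 : ℕ) = (p.1 : ℕ) + 1 →
      ((q.2 : ℕ) = (p.2 : ℕ) + 1 ∨ (p.2 : ℕ) = (q.2 : ℕ) + 1) →
      ¬(A p = 0 ∧ A q = 1)}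

/-- The number of `±1`-walks with `m` steps that start at `s` and stay in `[0, N]`. -/
def stripWalks (N : ℤ) : ℕ → ℤ → ℤ
  | 0, s => if 0 ≤ s ∧ s ≤ N then 1 else 0
  | m + 1, s => if 0 ≤ s ∧ s ≤ N then stripWalks N m (s - 1) + stripWalks N m (s + 1) else 0

lemma stripWalks_of_not {N s : ℤ} (h : ¬(0 ≤ s ∧ s ≤ N)) (m : ℕ) : stripWalks N m s = 0 := by
  cases m <;> simp only [stripWalks, if_neg h]

lemma stripWalks_succ {N s : ℤ} (h0 : 0 ≤ s) (hN : s ≤ N) (m : ℕ) :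
    stripWalks N (m + 1) s = stripWalks N m (s - 1) + stripWalks N m (s + 1) := by
  simp only [stripWalks, if_pos (And.intro h0 hN)]

lemma stripWalks_reflect (N : ℤ) (m : ℕ) (s : ℤ) :
    stripWalks N m (N - s) = stripWalks N m s := by
  induction m generalizing s with
  | zero => simp only [stripWalks]; congr 1; apply propext; omega
  | succ m ih =>
    have h : (0 ≤ N - s ∧ N - s ≤ N) ↔ (0 ≤ s ∧ s ≤ N) := by omega
    simp only [stripWalks, h]
    rw [show N - s - 1 = N - (s + 1) by ring, show N - s + 1 = N - (s - 1) by ring, ih, ih,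
      add_comm]

/-- The number of `±1`-walks with `m` steps whose number of up-steps is less than `t`. -/
def upStepsLT (m : ℕ) (t : ℕ) : ℤ := ∑ d ∈ Finset.range t, (m.choose d : ℤ)

lemma upStepsLT_succ_succ (m t : ℕ) :
    upStepsLT (m + 1) (t + 1) = upStepsLT m (t + 1) + upStepsLT m t := by
  unfold upStepsLT
  induction t with
  | zero => simp
  | succ t ih =>
    rw [Finset.sum_range_succ, ih, Finset.sum_range_succ _ (t + 1), Finset.sum_range_succ _ t,
      Nat.choose_succ_succ]
    push_cast
    ring

/-- The reflection principle in recursive form: walks from `s` that stay nonnegative. -/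
lemma stripWalks_eq_upStepsLT {N : ℤ} (m s : ℕ) (h : (s + m : ℤ) ≤ N) :
    stripWalks N m s = upStepsLT m ((m + s + 1) / 2 + 1) - upStepsLT m ((m + 1 - s) / 2) := by
  induction m generalizing s with
  | zero =>
    have h0 : (0 + 1 - s) / 2 = 0 := by omega
    simp only [stripWalks]
    rw [if_pos (by omega), h0]
    simp [upStepsLT, Finset.sum_range_succ']
  | succ m ih =>
    push_cast at h
    rw [stripWalks_succ (by omega) (by omega)]
    have hs : stripWalks N m (s + 1) =
        upStepsLT m ((m + s) / 2 + 1 + 1) - upStepsLT m ((m - s) / 2) := by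
      have := ih (s + 1) (by push_cast; omega)
      push_cast at this
      rw [this, show (m + (s + 1) + 1) / 2 = (m + s) / 2 + 1 by omega]
    have hp : stripWalks N m (s - 1) =
        upStepsLT m ((m + s) / 2 + 1) - upStepsLT m ((m + 2 - s) / 2) := by
      rcases s with _ | s
      · rw [stripWalks_of_not (by simp)]
        simp
      · have := ih s (by push_cast at h; omega)
        push_cast
        rw [add_sub_cancel_right, this, show m + (s + 1) = m + s + 1 by ring]
    rw [hs, hp, show (m + 1 + s + 1) / 2 + 1 = (m + s) / 2 + 1 + 1 by omega,
      upStepsLT_succ_succ, show m + 1 + 1 - s = m + 2 - s by omega]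
    rcases le_or_gt s m with hsm | hsm
    · rw [show (m + 2 - s) / 2 = (m - s) / 2 + 1 by omega, upStepsLT_succ_succ]
      ring
    · rw [show (m + 2 - s) / 2 = 0 by omega, show (m - s) / 2 = 0 by omega]
      simp only [upStepsLT, Finset.range_zero, Finset.sum_empty]
      ring

lemma stripWalks_zero_right {N : ℤ} {m : ℕ} (h : (m : ℤ) ≤ N) :
    stripWalks N m 0 = m.choose ((m + 1) / 2) := by
  have := stripWalks_eq_upStepsLT (N := N) m 0 (by simpa using h)
  rw [Nat.cast_zero] at this
  rw [this, upStepsLT, upStepsLT, Nat.add_zero, Nat.sub_zero, Finset.sum_range_succ]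
  ring

lemma stripWalks_two_mul_zero {N : ℤ} {j : ℕ} (h : (2 * j : ℤ) ≤ N) :
    stripWalks N (2 * j) 0 = j.centralBinom := by
  rw [stripWalks_zero_right (by push_cast; exact h), show (2 * j + 1) / 2 = j by omega,
    Nat.centralBinom]

lemma two_mul_stripWalks_two_mul_add_one_zero {N : ℤ} {j : ℕ} (h : (2 * j + 1 : ℤ) ≤ N) :
    2 * stripWalks N (2 * j + 1) 0 = (j + 1).centralBinom := by
  rw [stripWalks_zero_right (by push_cast; exact h), show (2 * j + 1 + 1) / 2 = j + 1 by omega,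
    Nat.centralBinom, show 2 * (j + 1) = 2 * j + 1 + 1 by ring, Nat.choose_succ_succ' (2 * j + 1),
    Nat.choose_symm_half]
  push_cast
  ring

/-- The number of walks in `[0, N]` starting at one of `c, c + 2, …, c + 2 (k - 1)`. -/
def stripWalksFrom (N : ℤ) (c : ℤ) (k m : ℕ) : ℤ :=
  ∑ i ∈ Finset.range k, stripWalks N m (2 * i + c)

lemma stripWalksFrom_succ {N c : ℤ} {k : ℕ} (hc : 0 ≤ c) (hN : 2 * k + c ≤ N + 2) (m : ℕ) :
    stripWalksFrom N c k (m + 1) =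
      stripWalksFrom N (c - 1) k m + stripWalksFrom N (c + 1) k m := by
  unfold stripWalksFrom
  rw [← Finset.sum_add_distrib]
  refine Finset.sum_congr rfl fun i hi => ?_
  have := Finset.mem_range.1 hi
  rw [stripWalks_succ (by omega) (by omega), add_sub_assoc, add_assoc]

lemma stripWalksFrom_shift (N c : ℤ) (k m : ℕ) :
    stripWalks N m c + stripWalksFrom N (c + 2) k m = stripWalksFrom N c (k + 1) m := by
  unfold stripWalksFrom
  rw [Finset.sum_range_succ', add_comm]
  congr 1
  · refine Finset.sum_congr rfl fun i _ => ?_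
    push_cast
    ring_nf
  · simp

lemma stripWalksFrom_succ_right (N c : ℤ) (k m : ℕ) :
    stripWalksFrom N c (k + 1) m = stripWalksFrom N c k m + stripWalks N m (2 * k + c) :=
  Finset.sum_range_succ _ _

lemma stripWalksFrom_zero {N c : ℤ} {k : ℕ} (hc : 0 ≤ c) (hN : 2 * k + c ≤ N + 2) :
    stripWalksFrom N c k 0 = k := by
  unfold stripWalksFrom
  rw [Finset.sum_congr rfl (g := fun _ => (1 : ℤ))]
  · simp
  · intro i hi
    have := Finset.mem_range.1 hi
    simp only [stripWalks]
    rw [if_pos (by omega)]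

lemma stripWalksFrom_even_succ_of_odd (M m : ℕ) :
    stripWalksFrom (2 * M + 1) 0 (M + 1) (m + 1) =
      2 * stripWalksFrom (2 * M + 1) 1 (M + 1) m - stripWalks (2 * M + 1) m 0 := by
  have h1 := stripWalksFrom_succ (N := 2 * M + 1) (c := 0) (k := M + 1) le_rfl
    (by push_cast; omega) m
  have h2 := stripWalksFrom_shift (2 * M + 1) (-1) (M + 1) m
  have h3 := stripWalksFrom_succ_right (2 * M + 1) (-1) (M + 1) m
  have h4 := stripWalks_reflect (2 * M + 1) m 0
  rw [stripWalks_of_not (by omega)] at h2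
  rw [show 2 * ((M + 1 : ℕ) : ℤ) + -1 = 2 * M + 1 - 0 by push_cast; ring, h4] at h3
  norm_num at h1 h2 h3
  linarith

lemma stripWalksFrom_odd_succ_of_odd (M m : ℕ) :
    stripWalksFrom (2 * M + 1) 1 (M + 1) (m + 1) =
      2 * stripWalksFrom (2 * M + 1) 0 (M + 1) m - stripWalks (2 * M + 1) m 0 := by
  have h1 := stripWalksFrom_succ (N := 2 * M + 1) (c := 1) (k := M + 1) zero_le_one
    (by push_cast; omega) m
  have h2 := stripWalksFrom_shift (2 * M + 1) 0 (M + 1) m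
  have h3 := stripWalksFrom_succ_right (2 * M + 1) 0 (M + 1) m
  rw [stripWalks_of_not (by push_cast; omega)] at h3
  norm_num at h1 h2 h3
  linarith

/-- In a strip with an even number of points, both parity classes of starting points give the same
number of walks. -/
lemma stripWalksFrom_of_odd {M j : ℕ} (h : 2 * j ≤ 2 * M + 1) :
    2 * stripWalksFrom (2 * M + 1) 0 (M + 1) (2 * j) =
        4 ^ j * (2 * M + 3) - (4 * j + 1) * j.centralBinom ∧
      2 * stripWalksFrom (2 * M + 1) 1 (M + 1) (2 * j) =
        4 ^ j * (2 * M + 3) - (4 * j + 1) * j.centralBinom := by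
  induction j with
  | zero =>
    rw [Nat.mul_zero, stripWalksFrom_zero le_rfl (by push_cast; omega),
      stripWalksFrom_zero zero_le_one (by push_cast; omega)]
    simp
    ring
  | succ j ih =>
    obtain ⟨ih0, ih1⟩ := ih (by omega)
    have h0 := stripWalks_two_mul_zero (N := 2 * M + 1) (j := j) (by omega)
    have h1 := two_mul_stripWalks_two_mul_add_one_zero (N := 2 * M + 1) (j := j) (by omega)
    have hc : ((j : ℤ) + 1) * (j + 1).centralBinom = 2 * (2 * j + 1) * j.centralBinom := by
      exact_mod_cast Nat.succ_mul_centralBinom_succ j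
    simp only [show 2 * (j + 1) = 2 * j + 1 + 1 by ring, stripWalksFrom_even_succ_of_odd,
      stripWalksFrom_odd_succ_of_odd, h0, pow_succ]
    push_cast
    constructor <;> linarith

lemma stripWalksFrom_of_odd_of_odd {M j : ℕ} (h : 2 * j ≤ 2 * M + 1) :
    stripWalksFrom (2 * M + 1) 0 (M + 1) (2 * j + 1) =
        4 ^ j * (2 * M + 3) - (4 * j + 2) * j.centralBinom ∧
      stripWalksFrom (2 * M + 1) 1 (M + 1) (2 * j + 1) =
        4 ^ j * (2 * M + 3) - (4 * j + 2) * j.centralBinom := by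
  obtain ⟨h0, h1⟩ := stripWalksFrom_of_odd h
  rw [stripWalksFrom_even_succ_of_odd, stripWalksFrom_odd_succ_of_odd,
    stripWalks_two_mul_zero (by omega)]
  constructor <;> linarith

lemma stripWalksFrom_even_succ_of_even (M m : ℕ) :
    stripWalksFrom (2 * M) 0 (M + 1) (m + 1) = 2 * stripWalksFrom (2 * M) 1 M m := by
  have h1 := stripWalksFrom_succ (N := 2 * M) (c := 0) (k := M + 1) le_rfl
    (by push_cast; omega) m
  have h2 := stripWalksFrom_shift (2 * M) (-1) M m
  have h3 := stripWalksFrom_succ_right (2 * M) 1 M m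
  rw [stripWalks_of_not (by omega)] at h2 h3
  norm_num at h1 h2 h3
  linarith

lemma stripWalksFrom_odd_succ_of_even (M m : ℕ) :
    stripWalksFrom (2 * M) 1 M (m + 1) =
      2 * stripWalksFrom (2 * M) 0 (M + 1) m - 2 * stripWalks (2 * M) m 0 := by
  have h1 := stripWalksFrom_succ (N := 2 * M) (c := 1) (k := M) zero_le_one (by omega) m
  have h2 := stripWalksFrom_shift (2 * M) 0 M m
  have h3 := stripWalksFrom_succ_right (2 * M) 0 M m
  have h4 := stripWalks_reflect (2 * M) m 0
  rw [sub_zero] at h4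
  rw [add_zero, h4] at h3
  norm_num at h1 h2 h3
  linarith

lemma stripWalksFrom_of_even {M j : ℕ} (h : 2 * j ≤ 2 * M) :
    stripWalksFrom (2 * M) 0 (M + 1) (2 * j) =
        4 ^ j * (M + 1) - 2 * j * j.centralBinom ∧
      stripWalksFrom (2 * M) 1 M (2 * j) =
        4 ^ j * (M + 1) - (2 * j + 1) * j.centralBinom := by
  induction j with
  | zero =>
    rw [Nat.mul_zero, stripWalksFrom_zero le_rfl (by push_cast; omega),
      stripWalksFrom_zero zero_le_one (by omega)]
    simp
  | succ j ih =>
    obtain ⟨ih0, ih1⟩ := ih (by omega)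
    have h0 := stripWalks_two_mul_zero (N := 2 * M) (j := j) (by omega)
    have h1 := two_mul_stripWalks_two_mul_add_one_zero (N := 2 * M) (j := j) (by omega)
    have hc : ((j : ℤ) + 1) * (j + 1).centralBinom = 2 * (2 * j + 1) * j.centralBinom := by
      exact_mod_cast Nat.succ_mul_centralBinom_succ j
    simp only [show 2 * (j + 1) = 2 * j + 1 + 1 by ring, stripWalksFrom_even_succ_of_even,
      stripWalksFrom_odd_succ_of_even, h0, pow_succ]
    push_cast
    constructor <;> linarith

/-- Two natural numbers that differ by one. -/
def Adjacent (a b : ℕ) : Prop := b = a + 1 ∨ a = b + 1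

/-- Consecutive values of `h` differ by one. -/
def IsPath {K m : ℕ} (h : Fin m → Fin K) : Prop :=
  ∀ i j : Fin m, (j : ℕ) = i + 1 → Adjacent (h i) (h j)

/-- The paths in `{0, …, K - 1}` with `m + 1` points whose initial point satisfies `P`. -/
abbrev PathsFrom (K m : ℕ) (P : Fin K → Prop) : Type :=
  {h : Fin (m + 1) → Fin K // P (h 0) ∧ IsPath h}

lemma isPath_cons_iff {K m : ℕ} {s : Fin K} {g : Fin (m + 1) → Fin K} :
    IsPath (Fin.cons s g : Fin (m + 2) → Fin K) ↔ Adjacent s (g 0) ∧ IsPath g := by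
  constructor
  · intro h
    refine ⟨by simpa using h 0 1 (by simp), fun i j hij => ?_⟩
    simpa using h i.succ j.succ (by simp [hij])
  · rintro ⟨h0, h⟩ i j hij
    induction j using Fin.cases with
    | zero => simp at hij
    | succ j =>
      induction i using Fin.cases with
      | zero =>
        have : j = 0 := by ext; simpa using hij
        simpa [this] using h0
      | succ i => simpa using h i j (by simpa using hij)

lemma card_pathsFrom_eq_sum (K m : ℕ) (P : Fin K → Prop) [DecidablePred P] :
    Nat.card (PathsFrom K m P) =
      ∑ s : Fin K, if P s then Nat.card (PathsFrom K m (· = s)) else 0 := by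
  have e : PathsFrom K m P ≃ Σ s : {s // P s}, PathsFrom K m (· = s.1) :=
    { toFun h := ⟨⟨h.1 0, h.2.1⟩, h.1, rfl, h.2.2⟩
      invFun x := ⟨x.2.1, by rw [x.2.2.1]; exact x.1.2, x.2.2.2⟩
      left_inv _ := rfl
      right_inv := by
        rintro ⟨⟨s, hs⟩, h, h0, hh⟩
        obtain rfl : h 0 = s := h0
        rfl }
  rw [Nat.card_congr e, Nat.card_sigma, ← Finset.sum_filter]
  exact (Finset.sum_subtype _ (by simp) fun s => Nat.card (PathsFrom K m (· = s))).symm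

lemma card_pathsFrom_succ (K m : ℕ) (s : Fin K) :
    Nat.card (PathsFrom K (m + 1) (· = s)) =
      Nat.card (PathsFrom K m fun t : Fin K => Adjacent s t) := by
  refine Nat.card_congr
    { toFun h := ⟨Fin.tail h.1, ?_⟩
      invFun g := ⟨Fin.cons s g.1, by simp, isPath_cons_iff.2 g.2⟩
      left_inv := ?_
      right_inv _ := by simp }
  · obtain ⟨h, rfl, hh⟩ := h
    rw [← Fin.cons_self_tail h] at hh
    exact isPath_cons_iff.1 hh
  · rintro ⟨h, rfl, hh⟩
    simp

lemma card_pathsFrom_zero (K : ℕ) (s : Fin K) : Nat.card (PathsFrom K 0 (· = s)) = 1 := by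
  rw [Nat.card_eq_one_iff_unique]
  refine ⟨⟨?_⟩, ⟨fun _ => s, rfl, fun i j hij => by omega⟩⟩
  rintro ⟨g, hg, -⟩ ⟨h, hh, -⟩
  ext i
  simp only [Fin.fin_one_eq_zero i, hg, hh]

lemma sum_adjacent {N : ℕ} {f : ℤ → ℤ} (h0 : f (-1) = 0) (hN : f (N + 1) = 0) {s : ℕ} (hs : s ≤ N)
    [DecidableRel Adjacent] :
    (∑ t : Fin (N + 1), if Adjacent s t then f (t : ℕ) else 0) = f (s - 1) + f (s + 1) := by
  rw [Fin.sum_univ_eq_sum_range (fun t : ℕ => if Adjacent s t then f t else 0) (N + 1)]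
  have hsplit : ∀ t ∈ Finset.range (N + 1), (if Adjacent s t then f t else 0) =
      (if s = t + 1 then f t else 0) + (if t = s + 1 then f t else 0) := by
    intro t _
    unfold Adjacent
    split_ifs <;> omega
  rw [Finset.sum_congr rfl hsplit, Finset.sum_add_distrib]
  congr 1
  · rcases s with _ | s
    · simpa using h0.symm
    · simp only [Nat.add_right_cancel_iff, Finset.sum_ite_eq, Finset.mem_range]
      rw [if_pos (by omega)]
      push_cast
      ring_nf
  · rw [Finset.sum_ite_eq']
    split_ifs with h
    · push_cast
      rfl
    · rw [Finset.mem_range] at h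
      rw [show s = N by omega, hN]

lemma card_pathsFrom_eq_stripWalks (N m : ℕ) (s : Fin (N + 1)) :
    (Nat.card (PathsFrom (N + 1) m (· = s)) : ℤ) = stripWalks N m (s : ℕ) := by
  classical
  induction m generalizing s with
  | zero =>
    rw [card_pathsFrom_zero, stripWalks, if_pos (by omega)]
    rfl
  | succ m ih =>
    rw [card_pathsFrom_succ, card_pathsFrom_eq_sum, stripWalks_succ (by omega) (by omega)]
    push_cast
    simp only [ih]
    exact sum_adjacent (stripWalks_of_not (by omega) m) (stripWalks_of_not (by omega) m)
      (by omega)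

lemma card_pathsFrom_mod_two (N m c : ℕ) :
    (Nat.card (PathsFrom (N + 1) m (fun s => (s : ℕ) % 2 = c)) : ℤ) =
      ∑ s ∈ Finset.range (N + 1), if s % 2 = c then stripWalks N m s else 0 := by
  rw [card_pathsFrom_eq_sum]
  push_cast
  simp only [card_pathsFrom_eq_stripWalks]
  exact Fin.sum_univ_eq_sum_range (fun s : ℕ => if s % 2 = c then stripWalks N m s else 0) (N + 1)

lemma sum_range_two_mul_mod_two_eq_zero (f : ℤ → ℤ) (k : ℕ) :
    (∑ s ∈ Finset.range (2 * k), if s % 2 = 0 then f s else 0) =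
      ∑ i ∈ Finset.range k, f (2 * i + 0) := by
  induction k with
  | zero => simp
  | succ k ih =>
    rw [show 2 * (k + 1) = 2 * k + 1 + 1 by ring, Finset.sum_range_succ, Finset.sum_range_succ, ih,
      Finset.sum_range_succ, if_pos (by omega), if_neg (by omega)]
    simp

lemma sum_range_two_mul_mod_two_eq_one (f : ℤ → ℤ) (k : ℕ) :
    (∑ s ∈ Finset.range (2 * k), if s % 2 = 1 then f s else 0) =
      ∑ i ∈ Finset.range k, f (2 * i + 1) := by
  induction k with
  | zero => simp
  | succ k ih =>
    rw [show 2 * (k + 1) = 2 * k + 1 + 1 by ring, Finset.sum_range_succ, Finset.sum_range_succ, ih,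
      Finset.sum_range_succ, if_neg (by omega), if_pos (by omega)]
    simp

lemma IsPath.mod_two {K m c : ℕ} {h : Fin (m + 1) → Fin K} (hh : IsPath h)
    (h0 : (h 0 : ℕ) % 2 = c) (j : Fin (m + 1)) : (h j + j : ℕ) % 2 = c := by
  induction j using Fin.induction with
  | zero => simpa using h0
  | succ j ih =>
    have := hh j.castSucc j.succ (by simp)
    unfold Adjacent at this
    simp only [Fin.val_succ, Fin.val_castSucc] at *
    omega

/-- The property of having no pattern `01` along a diagonal or antidiagonal. -/
def AvoidsDiagonal {n : ℕ} (A : Fin n × Fin n → Fin 2) : Prop :=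
  ∀ p q : Fin n × Fin n, (q.1 : ℕ) = (p.1 : ℕ) + 1 →
    ((q.2 : ℕ) = (p.2 : ℕ) + 1 ∨ (p.2 : ℕ) = (q.2 : ℕ) + 1) → ¬(A p = 0 ∧ A q = 1)

/-- The colour of a cell in the chessboard colouring. -/
def cellColor {n : ℕ} (p : Fin n × Fin n) : Fin 2 := ⟨(p.1 + p.2) % 2, by omega⟩

/-- The array whose ones of each colour are the cells below the graph of the path of that
colour. -/
def arrayOfPaths {n K : ℕ} (h : Fin 2 → Fin n → Fin K) (p : Fin n × Fin n) : Fin 2 :=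
  if (p.1 : ℕ) < h (cellColor p) p.2 then 1 else 0

lemma avoidsDiagonal_arrayOfPaths {n K : ℕ} {h : Fin 2 → Fin n → Fin K} (hh : ∀ c, IsPath (h c)) :
    AvoidsDiagonal (arrayOfPaths h) := by
  rintro p q h1 h2 ⟨hp, hq⟩
  have hc : cellColor q = cellColor p := by
    simp only [cellColor, Fin.mk.injEq]
    omega
  simp only [arrayOfPaths, hc] at hp hq
  have hp' : ¬((p.1 : ℕ) < h (cellColor p) p.2) := fun h => by simp [h] at hp
  have hq' : (q.1 : ℕ) < h (cellColor p) q.2 := by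
    by_contra h
    simp [h] at hq
  have hadj : Adjacent (h (cellColor p) p.2) (h (cellColor p) q.2) ∨
      Adjacent (h (cellColor p) q.2) (h (cellColor p) p.2) :=
    h2.imp (hh _ _ _) (hh _ _ _)
  unfold Adjacent at hadj
  omega

/-- In an array avoiding the pattern, zeros propagate down a column within a colour class. -/
lemma AvoidsDiagonal.eq_zero_of_le {n : ℕ} {A : Fin n × Fin n → Fin 2} (hA : AvoidsDiagonal A)
    {i i' j : Fin n} (hi : A (i, j) = 0) (t : ℕ) (ht : (i' : ℕ) = i + 2 * t) : A (i', j) = 0 := by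
  induction t generalizing i' with
  | zero =>
    have : i' = i := by ext; simpa using ht
    rwa [this]
  | succ t ih =>
    have step {p q : Fin n × Fin n} (h1 : (q.1 : ℕ) = p.1 + 1)
        (h2 : (q.2 : ℕ) = p.2 + 1 ∨ (p.2 : ℕ) = q.2 + 1) (hp : A p = 0) : A q = 0 := by
      have := hA p q h1 h2
      omega
    obtain ⟨j', hj'⟩ : ∃ j' : Fin n, (j' : ℕ) = j + 1 ∨ (j : ℕ) = j' + 1 := by
      rcases Nat.eq_zero_or_pos (j : ℕ) with h | h
      · exact ⟨⟨1, by omega⟩, Or.inl (by simp [h])⟩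
      · exact ⟨⟨j - 1, by omega⟩, Or.inr (by simp; omega)⟩
    have h0 := ih (i' := ⟨i + 2 * t, by omega⟩) rfl
    have h1 := step (q := (⟨i + 2 * t + 1, by omega⟩, j')) rfl hj' h0
    exact step (by simp; omega) hj'.symm h1

lemma exists_paths_of_avoidsDiagonal {m : ℕ} {A : Fin (m + 1) × Fin (m + 1) → Fin 2}
    (hA : AvoidsDiagonal A) :
    ∃ h : (c : Fin 2) → PathsFrom (m + 3) m (fun s => (s : ℕ) % 2 = c),
      arrayOfPaths (fun c => (h c).1) = A := by
  classical
  let Q (c : Fin 2) (j : Fin (m + 1)) (v : ℕ) : Prop :=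
    (v + j) % 2 = (c : ℕ) ∧ ∀ hv : v < m + 1, A (⟨v, hv⟩, j) = 0
  have hQ (c j) : ∃ v, v ≤ m + 2 ∧ Q c j v := by
    rcases Nat.lt_or_ge ((m + 1 + j + c) % 2) 1 with h | h
    · exact ⟨m + 1, by omega, by omega, by omega⟩
    · exact ⟨m + 2, by omega, by omega, by omega⟩
  have hQ' (c j) : ∃ v, Q c j v := (hQ c j).imp fun _ => And.right
  let H (c : Fin 2) (j : Fin (m + 1)) : Fin (m + 3) := ⟨Nat.find (hQ' c j), by
    obtain ⟨v, hv, hv'⟩ := hQ c j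
    exact Nat.lt_succ_of_le ((Nat.find_min' _ hv').trans hv)⟩
  have hH (c j) : Q c j (H c j) := Nat.find_spec (hQ' c j)
  have hmin {c j v} (h : Q c j v) : (H c j : ℕ) ≤ v := Nat.find_min' _ h
  have hle (c) (i j : Fin (m + 1)) (hij : (j : ℕ) = i + 1 ∨ (i : ℕ) = j + 1) :
      (H c j : ℕ) ≤ H c i + 1 := by
    obtain ⟨h1, h2⟩ := hH c i
    refine hmin ⟨by omega, fun hv => ?_⟩
    have := hA (⟨H c i, by omega⟩, i) (⟨H c i + 1, hv⟩, j) rfl hij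
    have := h2 (by omega)
    omega
  have hpath (c) : IsPath (H c) := by
    intro i j hij
    have h1 := hle c i j (Or.inl hij)
    have h2 := hle c j i (Or.inr hij)
    have h3 := (hH c i).1
    have h4 := (hH c j).1
    unfold Adjacent
    omega
  refine ⟨fun c => ⟨H c, by simpa using (hH c 0).1, hpath c⟩, ?_⟩
  ext ⟨i, j⟩ : 1
  set c := cellColor (i, j) with hc
  have hcval : (c : ℕ) = (i + j) % 2 := rfl
  simp only [arrayOfPaths, ← hc]
  split_ifs with hlt
  · by_contra hne
    exact absurd (hmin (c := c) (j := j) (v := i) ⟨hcval.symm, fun _ => by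
      simp only [Fin.eta]; omega⟩) (by omega)
  · obtain ⟨h1, h2⟩ := hH c j
    exact (hA.eq_zero_of_le (h2 (by omega)) ((i - H c j) / 2) (by simp only; omega)).symm

lemma arrayOfPaths_injective {m : ℕ}
    {g h : (c : Fin 2) → PathsFrom (m + 3) m (fun s => (s : ℕ) % 2 = c)}
    (hgh : arrayOfPaths (fun c => (g c).1) = arrayOfPaths (fun c => (h c).1)) : g = h := by
  have key {g h : (c : Fin 2) → PathsFrom (m + 3) m (fun s => (s : ℕ) % 2 = c)}
      (hgh : arrayOfPaths (fun c => (g c).1) = arrayOfPaths (fun c => (h c).1)) (c : Fin 2)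
      (j : Fin (m + 1)) : ¬(((g c).1 j : ℕ) < (h c).1 j) := by
    intro hlt
    have h1 := (g c).2.2.mod_two (g c).2.1 j
    have h2 := (h c).2.2.mod_two (h c).2.1 j
    have hlt' : ((g c).1 j : ℕ) < m + 1 := by omega
    have hA := congrFun hgh (⟨(g c).1 j, hlt'⟩, j)
    have hc : cellColor (⟨((g c).1 j : ℕ), hlt'⟩, j) = c := Fin.ext h1
    simp only [arrayOfPaths] at hA
    rw [hc] at hA
    simp [hlt] at hA
  funext c
  ext j
  have h1 := key hgh c j
  have h2 := key hgh.symm c j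
  omega

lemma a188818_succ_eq_mul (m : ℕ) :
    a188818 (m + 1) = Nat.card (PathsFrom (m + 3) m (fun s => (s : ℕ) % 2 = 0)) *
      Nat.card (PathsFrom (m + 3) m (fun s => (s : ℕ) % 2 = 1)) := by
  have e : ((c : Fin 2) → PathsFrom (m + 3) m (fun s => (s : ℕ) % 2 = c)) ≃
      {A : Fin (m + 1) × Fin (m + 1) → Fin 2 // AvoidsDiagonal A} :=
    Equiv.ofBijective
      (fun h => ⟨arrayOfPaths fun c => (h c).1, avoidsDiagonal_arrayOfPaths fun c => (h c).2.2⟩)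
      ⟨fun g h hgh => arrayOfPaths_injective (congrArg Subtype.val hgh),
        fun A => (exists_paths_of_avoidsDiagonal A.2).imp fun _ h => Subtype.ext h⟩
  have := (Nat.card_congr e).symm
  rw [Nat.card_pi, Fin.prod_univ_two] at this
  exact this

lemma a188818_even {k : ℕ} (hk : 1 ≤ k) :
    (a188818 (2 * k) : ℚ) = ((2 * k + 3) * 4 ^ k / 4 - k * k.centralBinom) ^ 2 := by
  obtain ⟨j, rfl⟩ : ∃ j, k = j + 1 := ⟨k - 1, by omega⟩
  have hN : ((2 * j + 1 + 2 : ℕ) : ℤ) = 2 * ((j + 1 : ℕ) : ℤ) + 1 := by push_cast; ring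
  have hw := stripWalksFrom_of_odd_of_odd (M := j + 1) (j := j) (by omega)
  have h0 := card_pathsFrom_mod_two (2 * j + 1 + 2) (2 * j + 1) 0
  have h1 := card_pathsFrom_mod_two (2 * j + 1 + 2) (2 * j + 1) 1
  rw [show 2 * j + 1 + 2 + 1 = 2 * (j + 1 + 1) by ring, hN,
    sum_range_two_mul_mod_two_eq_zero (fun s => stripWalks _ (2 * j + 1) s)] at h0
  rw [show 2 * j + 1 + 2 + 1 = 2 * (j + 1 + 1) by ring, hN,
    sum_range_two_mul_mod_two_eq_one (fun s => stripWalks _ (2 * j + 1) s)] at h1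
  replace h0 := h0.trans hw.1
  replace h1 := h1.trans hw.2
  have hc : ((j : ℚ) + 1) * (j + 1).centralBinom = 2 * (2 * j + 1) * j.centralBinom := by
    exact_mod_cast Nat.succ_mul_centralBinom_succ j
  have ha := a188818_succ_eq_mul (2 * j + 1)
  rw [← Int.cast_inj (α := ℚ)] at h0 h1
  rw [show 2 * (j + 1) = 2 * j + 1 + 1 by ring, ha]
  push_cast at h0 h1 ⊢
  rw [show 2 * j + 1 + 3 = 2 * (j + 1 + 1) by ring, h0, h1, hc]
  ring

lemma a188818_odd (k : ℕ) :
    (a188818 (2 * k + 1) : ℚ) = ((k + 2) * 4 ^ k - 2 * k * k.centralBinom) *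
      ((k + 2) * 4 ^ k - (2 * k + 1) * k.centralBinom) := by
  have hN : ((2 * k + 2 : ℕ) : ℤ) = 2 * ((k + 1 : ℕ) : ℤ) := by push_cast; ring
  have hw := stripWalksFrom_of_even (M := k + 1) (j := k) (by omega)
  have h0 := card_pathsFrom_mod_two (2 * k + 2) (2 * k) 0
  have h1 := card_pathsFrom_mod_two (2 * k + 2) (2 * k) 1
  rw [Finset.sum_range_succ, if_pos (by omega), hN, show 2 * k + 2 = 2 * (k + 1) by ring,
    sum_range_two_mul_mod_two_eq_zero (fun s => stripWalks _ (2 * k) s)] at h0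
  rw [Finset.sum_range_succ, if_neg (by omega), add_zero, hN, show 2 * k + 2 = 2 * (k + 1) by ring,
    sum_range_two_mul_mod_two_eq_one (fun s => stripWalks _ (2 * k) s)] at h1
  have h2 := stripWalksFrom_succ_right (2 * ((k + 1 : ℕ) : ℤ)) 0 (k + 1) (2 * k)
  rw [hw.1] at h2
  simp only [stripWalksFrom, add_zero] at h2
  replace h1 := h1.trans hw.2
  have ha := a188818_succ_eq_mul (2 * k)
  simp only [add_zero] at h0
  push_cast at h0 h1 h2
  rw [← h2, ← Int.cast_inj (α := ℚ)] at h0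
  rw [← Int.cast_inj (α := ℚ)] at h1
  rw [ha]
  push_cast at h0 h1 ⊢
  rw [show 2 * k + 3 = 2 * (k + 1) + 1 by ring, h0, h1]
  ring

open Polynomial in
/-- The coefficients of the recurrence satisfied by `a188818`. -/
noncomputable def recCoeff : Fin 6 → ℤ[X] :=
  ![
    -2048 * X ^ 10 - 11264 * X ^ 9 + 115712 * X ^ 7 + 303104 * X ^ 6 + 339968 * X ^ 5
      + 93184 * X ^ 4 - 290816 * X ^ 3 - 394240 * X ^ 2 - 153600 * X,
    512 * X ^ 10 + 768 * X ^ 9 - 13056 * X ^ 8 - 44288 * X ^ 7 - 10752 * X ^ 6 + 85504 * X ^ 5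
      - 56576 * X ^ 4 - 514304 * X ^ 3 - 818688 * X ^ 2 - 633600 * X - 207360,
    256 * X ^ 10 + 2048 * X ^ 9 + 1088 * X ^ 8 - 29120 * X ^ 7 - 87168 * X ^ 6 - 48256 * X ^ 5
      + 144000 * X ^ 4 + 298816 * X ^ 3 + 343296 * X ^ 2 + 288576 * X + 100224,
    -64 * X ^ 10 - 256 * X ^ 9 + 1200 * X ^ 8 + 6928 * X ^ 7 + 5104 * X ^ 6 - 14000 * X ^ 5
      + 2288 * X ^ 4 + 68432 * X ^ 3 + 68944 * X ^ 2 + 16080 * X + 6624,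
    -8 * X ^ 10 - 84 * X ^ 9 - 84 * X ^ 8 + 1400 * X ^ 7 + 4452 * X ^ 6 + 860 * X ^ 5
      - 12772 * X ^ 4 - 23092 * X ^ 3 - 31980 * X ^ 2 - 36684 * X - 15768,
    2 * X ^ 10 + 13 * X ^ 9 - 20 * X ^ 8 - 292 * X ^ 7 - 492 * X ^ 6 + 466 * X ^ 5
      + 1365 * X ^ 4 + 647 * X ^ 3 + 2553 * X ^ 2 + 5382 * X + 2376]

lemma degree_recCoeff_le (i : Fin 6) : (recCoeff i).degree ≤ 10 := by
  fin_cases i <;> simp only [recCoeff, Fin.reduceFinMk, Matrix.cons_val] <;> compute_degree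

lemma recCoeff_five_ne_zero : recCoeff 5 ≠ 0 := by
  intro h
  have h' := congrArg (Polynomial.eval 1) h
  simp only [recCoeff, Matrix.cons_val] at h'
  norm_num at h'

/-- The recurrence holds for any sequence given by the closed forms on even and odd indices. -/
lemma sum_recCoeff_mul_eq_zero {a : ℕ → ℤ}
    (heven : ∀ k : ℕ, 1 ≤ k →
      (a (2 * k) : ℚ) = ((2 * k + 3) * 4 ^ k / 4 - k * k.centralBinom) ^ 2)
    (hodd : ∀ k : ℕ,
      (a (2 * k + 1) : ℚ) = ((k + 2) * 4 ^ k - 2 * k * k.centralBinom) *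
        ((k + 2) * 4 ^ k - (2 * k + 1) * k.centralBinom))
    {n : ℕ} (hn : 1 ≤ n) :
    ∑ i : Fin 6, (recCoeff i).eval (n : ℤ) * a (n + (i : ℕ)) = 0 := by
  have hc (k : ℕ) : ((k : ℚ) + 1) * (k + 1).centralBinom = 2 * (2 * k + 1) * k.centralBinom := by
    exact_mod_cast Nat.succ_mul_centralBinom_succ k
  have hsolve {x y z w : ℚ} (hx : 0 < x) (h : x * y = z) (h' : x * w = z) : y = w :=
    mul_left_cancel₀ hx.ne' (h.trans h'.symm)
  rcases Nat.even_or_odd' n with ⟨k, rfl | rfl⟩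
  · obtain ⟨t, ht⟩ : ∃ t : ℚ, (k.centralBinom : ℚ) = (k + 1) * (k + 2) * t :=
      ⟨k.centralBinom / ((k + 1) * (k + 2)), by field_simp⟩
    have h1 : ((k + 1).centralBinom : ℚ) = 2 * (2 * k + 1) * (k + 2) * t :=
      hsolve (by positivity) (hc k) (by rw [ht]; ring)
    have h2 : ((k + 2).centralBinom : ℚ) = 4 * (2 * k + 1) * (2 * k + 3) * t :=
      hsolve (by positivity) (hc (k + 1)) (by rw [h1]; push_cast; ring)
    have e0 := heven k (by omega)
    have e1 := hodd k
    have e2 := heven (k + 1) (by omega)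
    have e3 := hodd (k + 1)
    have e4 := heven (k + 2) (by omega)
    have e5 := hodd (k + 2)
    rw [ht] at e0 e1
    rw [h1] at e2 e3
    rw [h2] at e4 e5
    rw [← Int.cast_inj (α := ℚ)]
    simp only [Fin.sum_univ_six, recCoeff, Fin.coe_ofNat_eq_mod, Matrix.cons_val]
    simp only [Polynomial.eval_add, Polynomial.eval_sub, Polynomial.eval_neg, Polynomial.eval_mul,
      Polynomial.eval_pow, Polynomial.eval_X, Polynomial.eval_ofNat]
    push_cast
    rw [show 2 * k + 2 = 2 * (k + 1) by ring, show 2 * k + 3 = 2 * (k + 1) + 1 by ring,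
      show 2 * k + 4 = 2 * (k + 2) by ring, show 2 * k + 5 = 2 * (k + 2) + 1 by ring,
      add_zero, e0, e1, e2, e3, e4, e5]
    push_cast
    ring
  · obtain ⟨t, ht⟩ : ∃ t : ℚ, (k.centralBinom : ℚ) = (k + 1) * (k + 2) * (k + 3) * t :=
      ⟨k.centralBinom / ((k + 1) * (k + 2) * (k + 3)), by field_simp⟩
    have h1 : ((k + 1).centralBinom : ℚ) = 2 * (2 * k + 1) * (k + 2) * (k + 3) * t :=
      hsolve (by positivity) (hc k) (by rw [ht]; ring)
    have h2 : ((k + 2).centralBinom : ℚ) = 4 * (2 * k + 1) * (2 * k + 3) * (k + 3) * t :=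
      hsolve (by positivity) (hc (k + 1)) (by rw [h1]; push_cast; ring)
    have h3 : ((k + 3).centralBinom : ℚ) =
        8 * (2 * k + 1) * (2 * k + 3) * (2 * k + 5) * t :=
      hsolve (by positivity) (hc (k + 2)) (by rw [h2]; push_cast; ring)
    have e0 := hodd k
    have e1 := heven (k + 1) (by omega)
    have e2 := hodd (k + 1)
    have e3 := heven (k + 2) (by omega)
    have e4 := hodd (k + 2)
    have e5 := heven (k + 3) (by omega)
    rw [ht] at e0
    rw [h1] at e1 e2
    rw [h2] at e3 e4
    rw [h3] at e5
    rw [← Int.cast_inj (α := ℚ)]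
    simp only [Fin.sum_univ_six, recCoeff, Fin.coe_ofNat_eq_mod, Matrix.cons_val]
    simp only [Polynomial.eval_add, Polynomial.eval_sub, Polynomial.eval_neg, Polynomial.eval_mul,
      Polynomial.eval_pow, Polynomial.eval_X, Polynomial.eval_ofNat]
    push_cast
    rw [show 2 * k + 1 + 1 = 2 * (k + 1) by ring, show 2 * k + 1 + 2 = 2 * (k + 1) + 1 by ring,
      show 2 * k + 1 + 3 = 2 * (k + 2) by ring, show 2 * k + 1 + 4 = 2 * (k + 2) + 1 by ring,
      show 2 * k + 1 + 5 = 2 * (k + 3) by ring,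
      add_zero, e0, e1, e2, e3, e4, e5]
    push_cast
    ring

/-- There are polynomials `p₀, …, p₅ ∈ ℤ[x]`, each of degree at most `10` and
with `p₅ ≠ 0`, such that `p₀(n)·a(n) + ⋯ + p₅(n)·a(n+5) = 0` for all `n ≥ 1`;
in particular `a188818` is D-finite. -/
theorem stmt15 :
    ∃ p : Fin 6 → Polynomial ℤ,
      (∀ i, (p i).degree ≤ 10) ∧ p 5 ≠ 0 ∧
      ∀ n : ℕ, 1 ≤ n →
        ∑ i : Fin 6, (p i).eval (n : ℤ) * (a188818 (n + (i : ℕ)) : ℤ) = 0 := by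
  refine ⟨recCoeff, degree_recCoeff_le, recCoeff_five_ne_zero, fun n hn => ?_⟩
  exact sum_recCoeff_mul_eq_zero (a := fun n => a188818 n)
    (fun k hk => by rw [Int.cast_natCast]; exact a188818_even hk)
    (fun k => by rw [Int.cast_natCast]; exact a188818_odd k) hn
end

section
/- Let N(i,j) denote the Narayana-type number N(i,j) = C(i+j−1, i)·C(i+j−1, i−1)/(i+j−1), where C denotes the binomial coefficient. Then for every integer n ≥ 1, a(n) = 2·∑_{j=1}^{n} ( ∑_{i=1}^{n} N(i,j) + (n − j − 1)·N(j,n) ) − 2·C(2n, n) + N(n,n) + 3, where the expression is evaluated in ℤ. -/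
/-- `a306322 n` is the number of `n × n` matrices with nonnegative integer
entries such that the top-left entry is `0`, the bottom-right entry is `2`, and
along every row, column and falling diagonal any two consecutive entries `e, e'`
satisfy `e' - e ∈ {0, 1}` (OEIS A306322). -/
noncomputable def a306322 (n : ℕ) : ℕ :=
  Nat.card {m : Fin n × Fin n → ℕ //
    (∀ p : Fin n × Fin n, (p.1 : ℕ) = 0 → (p.2 : ℕ) = 0 → m p = 0) ∧
    (∀ p : Fin n × Fin n, (p.1 : ℕ) = n - 1 → (p.2 : ℕ) = n - 1 → m p = 2) ∧
    (∀ p q : Fin n × Fin n,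
      ((q.1 = p.1 ∧ (q.2 : ℕ) = (p.2 : ℕ) + 1) ∨
       ((q.1 : ℕ) = (p.1 : ℕ) + 1 ∧ q.2 = p.2) ∨
       ((q.1 : ℕ) = (p.1 : ℕ) + 1 ∧ (q.2 : ℕ) = (p.2 : ℕ) + 1)) →
      m p ≤ m q ∧ m q ≤ m p + 1)}

/-- The Narayana-type number `N(i,j) = C(i+j-1,i)·C(i+j-1,i-1)/(i+j-1)`,
evaluated in `ℤ`. -/
def N18 (i j : ℕ) : ℤ :=
  (((i + j - 1).choose i : ℤ) * ((i + j - 1).choose (i - 1) : ℤ)) / ((i : ℤ) + (j : ℤ) - 1)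

section Counting

open Finset

/-- The number of chains of `k` pairs `(a, b)` with `a < b`, weakly decreasing in both
components and bounded by `(x, y)`. -/
def strictCount : ℕ → ℕ → ℕ → ℤ
  | 0, _, _ => 1
  | k + 1, x, y => ∑ a ∈ range (x + 1), ∑ b ∈ range (y + 1),
      if a < b then strictCount k a b else 0

/-- The number of chains of `k` pairs `(a, b)` with `a = 0`, `b = n` or `a < b`, weakly decreasing
in both components and bounded by `(x, y)`, each weighted by one plus the first component of its
last pair. -/
def stripCount (n : ℕ) : ℕ → ℕ → ℕ → ℤ
  | 0, x, _ => x + 1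
  | k + 1, x, y => ∑ a ∈ range (x + 1), ∑ b ∈ range (y + 1),
      if a = 0 ∨ b = n ∨ a < b then stripCount n k a b else 0

theorem sum_range_choose_add (x k : ℕ) :
    ∑ a ∈ range (x + 1), ((a + k).choose k : ℤ) = ((x + k + 1).choose (k + 1) : ℤ) := by
  induction x with
  | zero => simp
  | succ x ih =>
    rw [sum_range_succ, ih, show x + 1 + k + 1 = (x + k + 1) + 1 by ring,
      Nat.choose_succ_succ (x + k + 1) k, show x + 1 + k = x + k + 1 by ring]
    push_cast; ring

theorem sum_range_choose_add_succ (x k : ℕ) :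
    ∑ a ∈ range (x + 1), ((a + k).choose (k + 1) : ℤ) = ((x + k + 1).choose (k + 2) : ℤ) := by
  induction x with
  | zero => simp
  | succ x ih =>
    rw [sum_range_succ, ih, show x + 1 + k + 1 = (x + k + 1) + 1 by ring,
      Nat.choose_succ_succ (x + k + 1) (k + 1), show x + 1 + k = x + k + 1 by ring]
    push_cast; ring

theorem sum_lt_eq_det (j a y : ℕ) (h : a ≤ y) :
    ∑ b ∈ range (y + 1), (if a < b then
      ((a + (j + 1)).choose (j + 1) * (b + j).choose (j + 1)
        - (a + (j + 1)).choose (j + 2) * (b + j).choose j : ℤ) else 0) =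
      (a + (j + 1)).choose (j + 1) * (y + (j + 1)).choose (j + 2)
        - (a + (j + 1)).choose (j + 2) * (y + (j + 1)).choose (j + 1) := by
  induction y, h using Nat.le_induction with
  | base =>
    rw [sum_eq_zero]
    · ring
    · intro b hb
      rw [if_neg]
      simp at hb; omega
  | succ y h ih =>
    rw [sum_range_succ, ih, if_pos (by omega)]
    rw [show y + 1 + (j + 1) = (y + (j + 1)) + 1 by ring, Nat.choose_succ_succ _ (j + 1),
      Nat.choose_succ_succ _ j, show y + 1 + j = y + (j + 1) by ring]
    push_cast; ring

theorem strictCount_succ_eq_det (j : ℕ) : ∀ x y : ℕ, x ≤ y →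
    strictCount (j + 1) x y = (x + (j + 1)).choose (j + 1) * (y + j).choose (j + 1)
        - (x + (j + 1)).choose (j + 2) * (y + j).choose j := by
  induction j with
  | zero =>
    intro x y h
    simp only [strictCount]
    have key : ∀ a ∈ range (x + 1), ∑ b ∈ range (y + 1), (if a < b then (1 : ℤ) else 0)
        = y * (a + 0).choose 0 - (a + 0).choose (0 + 1) := by
      intro a ha
      have ha : a ≤ y := by simp at ha; omega
      clear h
      induction y, ha using Nat.le_induction with
      | base =>
        rw [sum_eq_zero]
        · simp
        · intro b hb
          rw [if_neg]
          simp at hb; omega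
      | succ y h ih =>
        rw [sum_range_succ, ih, if_pos (by omega)]
        push_cast; simp; ring
    rw [sum_congr rfl key, sum_sub_distrib, ← mul_sum, sum_range_choose_add,
      sum_range_choose_add_succ]
    simp; ring
  | succ j ih =>
    intro x y h
    rw [strictCount]
    have key : ∀ a ∈ range (x + 1), ∑ b ∈ range (y + 1),
        (if a < b then strictCount (j + 1) a b else 0) =
        (a + (j + 1)).choose (j + 1) * (y + (j + 1)).choose (j + 2)
        - (a + (j + 1)).choose (j + 2) * (y + (j + 1)).choose (j + 1) := by
      intro a ha
      rw [← sum_lt_eq_det j a y (by simp at ha; omega)]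
      refine sum_congr rfl fun b _ => ?_
      split_ifs with hab
      · rw [ih a b hab.le]
      · rfl
    rw [sum_congr rfl key, sum_sub_distrib, ← sum_mul, ← sum_mul, sum_range_choose_add,
      sum_range_choose_add_succ]
    rfl

theorem N18_succ_of_mul_eq (i y : ℕ) (hy : 1 ≤ y) (z : ℤ)
    (h : (y + i : ℤ) * z = (y + i).choose (i + 1) * (y + i).choose i) : N18 (i + 1) y = z := by
  rw [N18, show i + 1 + y - 1 = y + i by omega, Nat.add_sub_cancel, ← h]
  push_cast
  rw [show (i + 1 + y - 1 : ℤ) = y + i by ring]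
  exact Int.mul_ediv_cancel_left _ (by positivity)

theorem strictCount_self (j y : ℕ) (hy : 1 ≤ y) : strictCount j y y = N18 (j + 1) y := by
  symm
  apply N18_succ_of_mul_eq j y hy
  cases j with
  | zero => simp [strictCount]
  | succ j =>
    rw [strictCount_succ_eq_det j y y le_rfl]
    have h1 : ((y + j + 1) * (y + j).choose j : ℤ) = (y + j + 1).choose (j + 1) * (j + 1) := by
      exact_mod_cast Nat.add_one_mul_choose_eq (y + j) j
    have h2 : ((y + j).choose (j + 1) * (y + j + 1) : ℤ) = (y + j + 1).choose (j + 1) * y := by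
      have := Nat.choose_mul_succ_eq (y + j) (j + 1)
      rw [show y + j + 1 - (j + 1) = y by omega] at this
      exact_mod_cast this
    have h3 : ((y + j + 1).choose (j + 2) * (j + 2) : ℤ) = (y + j + 1).choose (j + 1) * y := by
      have := Nat.choose_succ_right_eq (y + j + 1) (j + 1)
      rw [show y + j + 1 - (j + 1) = y by omega] at this
      exact_mod_cast this
    simp only [← add_assoc] at *
    push_cast
    linear_combination ((y + j + 1).choose (j + 1) : ℤ) * h2 -
      ((y + j + 1).choose (j + 2) : ℤ) * h1 - ((y + j + 1).choose (j + 1) : ℤ) * h3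

theorem N18_comm (i j : ℕ) (hi : 1 ≤ i) (hj : 1 ≤ j) : N18 i j = N18 j i := by
  have h1 : (i + j - 1).choose i = (j + i - 1).choose (j - 1) := by
    rw [show j + i - 1 = i + j - 1 by omega]
    exact Nat.choose_symm_of_eq_add (by omega)
  have h2 : (i + j - 1).choose (i - 1) = (j + i - 1).choose j := by
    rw [show j + i - 1 = i + j - 1 by omega]
    exact Nat.choose_symm_of_eq_add (by omega)
  rw [N18, N18, h1, h2, mul_comm, add_comm (i : ℤ)]

theorem strictCount_of_le (j x y : ℕ) (h : y ≤ x) : strictCount j x y = strictCount j y y := by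
  cases j with
  | zero => rfl
  | succ j =>
    simp only [strictCount]
    symm
    apply sum_subset (by simpa using h)
    intro a _ ha
    apply sum_eq_zero
    intro b hb
    rw [if_neg]
    simp at ha hb; omega

theorem sum_Icc_one_eq_sum_range (f : ℕ → ℤ) (n : ℕ) :
    ∑ i ∈ Icc 1 n, f i = ∑ i ∈ range n, f (i + 1) := by
  induction n with
  | zero => simp
  | succ n ih => rw [sum_Icc_succ_top (by omega), ih, sum_range_succ]

theorem sum_range_sum_range (f : ℕ → ℤ) (n : ℕ) :
    ∑ y ∈ range n, ∑ t ∈ range y, f t = ∑ t ∈ range n, ((n : ℤ) - t - 1) * f t := by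
  induction n with
  | zero => simp
  | succ n ih =>
    rw [sum_range_succ, ih, sum_range_succ _ n, ← sum_add_distrib]
    push_cast
    rw [show ((n : ℤ) + 1 - n - 1) = 0 by ring, zero_mul, add_zero]
    exact sum_congr rfl fun t _ => by ring

/-- The number of chains as in `strictCount`, each weighted by one plus the first component of
its last pair. -/
def weightedStrictCount : ℕ → ℕ → ℕ → ℤ
  | 0, x, _ => x + 1
  | k + 1, x, y => ∑ a ∈ range (x + 1), ∑ b ∈ range (y + 1),
      if a < b then weightedStrictCount k a b else 0

theorem weightedStrictCount_zero_left (k y : ℕ) :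
    weightedStrictCount k 0 y = strictCount k 0 y := by
  induction k generalizing y with
  | zero => simp [weightedStrictCount, strictCount]
  | succ k ih => simp [weightedStrictCount, strictCount, ih]

theorem weightedStrictCount_succ_succ (k x y : ℕ) :
    weightedStrictCount k (x + 1) (y + 1) =
      strictCount k (x + 1) (y + 1) + weightedStrictCount k x y := by
  induction k generalizing x y with
  | zero => simp [weightedStrictCount, strictCount]; ring
  | succ k ih =>
    simp only [weightedStrictCount, strictCount]
    rw [sum_range_succ', sum_range_succ' _ (x + 1)]
    have h : ∀ a ∈ range (x + 1), ∑ b ∈ range (y + 1 + 1),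
        (if a + 1 < b then weightedStrictCount k (a + 1) b else 0) =
        ∑ b ∈ range (y + 1 + 1), (if a + 1 < b then strictCount k (a + 1) b else 0) +
        ∑ b ∈ range (y + 1), (if a < b then weightedStrictCount k a b else 0) := by
      intro a _
      rw [sum_range_succ', sum_range_succ' _ (y + 1)]
      simp only [Nat.not_lt_zero, if_false, add_zero, add_lt_add_iff_right]
      rw [← sum_add_distrib]
      refine sum_congr rfl fun b _ => ?_
      split_ifs
      · exact ih a b
      · simp
    rw [sum_congr rfl h, sum_add_distrib]
    simp only [weightedStrictCount_zero_left]
    ring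

theorem weightedStrictCount_eq_sum (k x y : ℕ) (h : y ≤ x) :
    weightedStrictCount (k + 1) x y = ∑ t ∈ range y, N18 (k + 2) (t + 1) := by
  induction y generalizing x with
  | zero => simp [weightedStrictCount]
  | succ y ih =>
    obtain ⟨x, rfl⟩ : ∃ x', x = x' + 1 := ⟨x - 1, by omega⟩
    rw [weightedStrictCount_succ_succ, ih x (by omega), strictCount_of_le _ _ _ h,
      strictCount_self _ _ (by omega), sum_range_succ, add_comm]

theorem strictCount_succ_zero (k x : ℕ) : strictCount (k + 1) x 0 = 0 := by
  simp [strictCount]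

theorem weightedStrictCount_zero_zero (k : ℕ) :
    weightedStrictCount k 0 0 + ∑ j ∈ range k, strictCount j 0 0 = 1 := by
  rw [weightedStrictCount_zero_left, add_comm, ← sum_range_succ (fun j => strictCount j 0 0)]
  rw [sum_range_succ']
  simp [strictCount]

theorem stripCount_eq (n k x y : ℕ) (hn : 1 ≤ n) (hx : x ≤ n) (hy : y ≤ n) (h : x < n ∨ y < n) :
    stripCount n k x y = weightedStrictCount k x y + ∑ j ∈ range k, strictCount j x y := by
  induction k generalizing x y with
  | zero => simp [stripCount, weightedStrictCount]
  | succ k ih =>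
    have key : ∀ a ∈ range (x + 1), ∀ b ∈ range (y + 1),
        (if a = 0 ∨ b = n ∨ a < b then stripCount n k a b else 0) =
        ((if a < b then weightedStrictCount k a b else 0) +
          ∑ j ∈ range k, (if a < b then strictCount j a b else 0)) +
          if a = 0 then (if b = 0 then 1 else 0) else 0 := by
      intro a ha b hb
      simp only [mem_range] at ha hb
      by_cases hab : a < b
      · rw [if_pos (by omega), ih a b (by omega) (by omega) (by omega)]
        simp only [hab, if_true]
        rw [show (if a = 0 then (if b = 0 then (1 : ℤ) else 0) else 0) = 0 by
          split_ifs <;> omega]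
        ring
      · by_cases h0 : a = 0
        · obtain rfl : b = 0 := by omega
          subst h0
          rw [if_pos (by omega), ih 0 0 (by omega) (by omega) (by omega),
            weightedStrictCount_zero_zero]
          simp
        · rw [if_neg (by omega)]
          simp [hab, h0]
    rw [stripCount, sum_congr rfl fun a ha => sum_congr rfl (key a ha)]
    simp only [sum_add_distrib]
    rw [sum_range_succ' _ k]
    simp only [weightedStrictCount, strictCount]
    rw [add_assoc]
    congr 1
    congr 1
    · rw [sum_comm]
      conv_rhs => rw [sum_comm]
      rw [sum_comm]
      refine sum_congr rfl fun a _ => ?_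
      rw [sum_comm]
    · simp

theorem stripCount_zero_left (n k y : ℕ) : stripCount n k 0 y = (y + k).choose k := by
  induction k generalizing y with
  | zero => simp [stripCount]
  | succ k ih =>
    simp only [stripCount, zero_add, sum_range_one, true_or, if_true, ih]
    exact sum_range_choose_add y k

theorem stripCount_top_succ (n k : ℕ) (hn : 1 ≤ n) :
    stripCount n (k + 1) n n = stripCount n k n n + 1 +
      (weightedStrictCount (k + 1) n n + ∑ j ∈ range k, strictCount (j + 1) n n) := by
  have key : ∀ a ∈ range (n + 1), ∀ b ∈ range (n + 1),
      (if a = 0 ∨ b = n ∨ a < b then stripCount n k a b else 0) =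
      ((if a < b then weightedStrictCount k a b else 0) +
        ∑ j ∈ range k, (if a < b then strictCount j a b else 0)) +
        (if a = 0 then (if b = 0 then 1 else 0) else 0) +
        (if a = n then (if b = n then stripCount n k n n else 0) else 0) := by
    intro a ha b hb
    simp only [mem_range] at ha hb
    by_cases hab : a < b
    · rw [if_pos (by omega), stripCount_eq n k a b hn (by omega) (by omega) (by omega)]
      have h0 : ¬ b = 0 := by omega
      have h1 : ¬ a = n := by omega
      simp [hab, h0, h1]
    · by_cases h0 : a = 0
      · obtain rfl : b = 0 := by omega
        subst h0
        rw [if_pos (by omega), stripCount_eq n k 0 0 hn (by omega) (by omega) (by omega),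
          weightedStrictCount_zero_zero]
        have h1 : ¬ 0 = n := by omega
        simp [h1]
      · by_cases h1 : b = n
        · obtain rfl : a = n := by omega
          subst h1
          simp [h0]
        · rw [if_neg (by omega)]
          simp [hab, h0, h1]
  rw [stripCount, sum_congr rfl fun a ha => sum_congr rfl (key a ha)]
  simp only [sum_add_distrib]
  simp only [weightedStrictCount, strictCount]
  have : ∑ a ∈ range (n + 1), ∑ b ∈ range (n + 1), ∑ j ∈ range k,
      (if a < b then strictCount j a b else 0) = ∑ j ∈ range k, ∑ a ∈ range (n + 1),
      ∑ b ∈ range (n + 1), (if a < b then strictCount j a b else 0) := by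
    conv_rhs => rw [sum_comm]
    refine sum_congr rfl fun a _ => ?_
    rw [sum_comm]
  rw [this]
  simp
  ring

theorem N18_one (y : ℕ) (hy : 1 ≤ y) : N18 1 y = 1 := by
  rw [← strictCount_self 0 y hy, strictCount]

theorem stripCount_top (n k : ℕ) (hn : 1 ≤ n) :
    stripCount n k n n = 1 + ∑ i ∈ range (k + 1), ∑ t ∈ range n, N18 (i + 1) (t + 1) +
      ∑ i ∈ range k, ((k : ℤ) - i) * N18 (i + 1) n := by
  induction k with
  | zero => simp [stripCount, N18_one]; ring
  | succ k ih =>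
    rw [stripCount_top_succ n k hn, ih, weightedStrictCount_eq_sum k n n le_rfl,
      sum_congr rfl fun j _ => strictCount_self (j + 1) n hn, sum_range_succ _ (k + 1)]
    have h : ∑ i ∈ range (k + 1), (((k + 1 : ℕ) : ℤ) - i) * N18 (i + 1) n =
        ∑ i ∈ range k, ((k : ℤ) - i) * N18 (i + 1) n + ∑ i ∈ range (k + 1), N18 (i + 1) n := by
      rw [sum_range_succ, sum_range_succ _ k, ← add_assoc, ← sum_add_distrib]
      congr 1
      · exact sum_congr rfl fun i _ => by push_cast; ring
      · push_cast; ring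
    rw [h, sum_range_succ' (fun i => N18 (i + 1) n) k, zero_add, N18_one n hn]
    ring

theorem sum_stripCount (m : ℕ) (hm : 1 ≤ m) :
    ∑ y ∈ range (m + 2), stripCount (m + 1) m (m + 1) y =
      2 * ∑ j ∈ Icc 1 (m + 1), ((∑ i ∈ Icc 1 (m + 1), N18 i j) +
        (((m + 1 : ℕ) : ℤ) - j - 1) * N18 j (m + 1)) + N18 (m + 1) (m + 1) + 2 := by
  have h1 : ∀ y ∈ range (m + 1), stripCount (m + 1) m (m + 1) y =
      ∑ t ∈ range y, N18 (t + 1) (m + 1) + ∑ j ∈ range m, strictCount j y y := by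
    intro y hy
    simp only [mem_range] at hy
    rw [stripCount_eq _ _ _ _ (by omega) le_rfl (by omega) (by omega)]
    congr 1
    · obtain ⟨k, rfl⟩ : ∃ k, m = k + 1 := ⟨m - 1, by omega⟩
      rw [weightedStrictCount_eq_sum _ _ _ (by omega)]
      exact sum_congr rfl fun t _ => N18_comm _ _ (by omega) (by omega)
    · exact sum_congr rfl fun j _ => strictCount_of_le _ _ _ (by omega)
  have h2 : ∑ y ∈ range (m + 1), ∑ j ∈ range m, strictCount j y y =
      1 + ∑ y ∈ range m, ∑ j ∈ range m, N18 (j + 1) (y + 1) := by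
    rw [sum_range_succ', add_comm]
    congr 1
    · obtain ⟨k, rfl⟩ : ∃ k, m = k + 1 := ⟨m - 1, by omega⟩
      rw [sum_range_succ']
      simp [strictCount]
    · exact sum_congr rfl fun y _ => sum_congr rfl fun j _ => strictCount_self _ _ (by omega)
  have h3 : ∑ i ∈ range m, N18 (m + 1) (i + 1) = ∑ i ∈ range m, N18 (i + 1) (m + 1) :=
    sum_congr rfl fun i _ => N18_comm _ _ (by omega) (by omega)
  rw [sum_range_succ, sum_congr rfl h1, sum_add_distrib, h2, sum_range_sum_range,
    stripCount_top _ _ (by omega)]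
  simp only [sum_Icc_one_eq_sum_range]
  rw [sum_comm (s := range (m + 1)) (t := range (m + 1))]
  simp only [sum_range_succ, sum_add_distrib, h3, sub_mul, sum_sub_distrib,
    mul_add, mul_sub]
  push_cast
  simp only [sum_add_distrib, add_mul, one_mul, ← mul_sum]
  ring

/-- The number of ways to append `k` rows below a row with `a` zeros and `b` entries `≤ 1`
to an `n`-column jump-free array so that the final row ends in a `2`. -/
def rowCount (n : ℕ) : ℕ → ℕ → ℕ → ℕ
  | 0, _, b => if b < n then 1 else 0
  | k + 1, a, b => ∑ a' ∈ range (a + 1), ∑ b' ∈ range (b + 1),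
      if a = 0 ∨ b' = n ∨ a < b' then rowCount n k a' b' else 0

theorem sum_rowCount (n k x y : ℕ) (hy : y ≤ n) :
    ∑ a ∈ range (x + 1), (rowCount n k a y : ℤ) =
      stripCount n k x y - if y = n then ((x + k + 1).choose (k + 1) : ℤ) else 0 := by
  induction k generalizing x y with
  | zero =>
    by_cases h : y = n
    · simp [rowCount, stripCount, h]
    · simp [rowCount, stripCount, h, show y < n by omega]
  | succ k ih =>
    have key : ∀ a ∈ range (x + 1), (rowCount n (k + 1) a y : ℤ) =
        ∑ b ∈ range (y + 1), (if a = 0 ∨ b = n ∨ a < b then stripCount n k a b else 0) -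
          if y = n then ((a + (k + 1)).choose (k + 1) : ℤ) else 0 := by
      intro a _
      rw [rowCount, sum_comm]
      push_cast
      have h : ∀ b ∈ range (y + 1), ∑ a' ∈ range (a + 1),
          (if a = 0 ∨ b = n ∨ a < b then (rowCount n k a' b : ℤ) else 0) =
          (if a = 0 ∨ b = n ∨ a < b then stripCount n k a b else 0) -
            if b = n then ((a + (k + 1)).choose (k + 1) : ℤ) else 0 := by
        intro b hb
        simp only [mem_range] at hb
        have := ih a b (by omega)
        by_cases hD : a = 0 ∨ b = n ∨ a < b
        · simp only [hD, if_true]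
          exact this
        · have hb' : ¬ b = n := by omega
          simp only [hD, if_false, sum_const_zero]
          rw [if_neg hb', sub_zero]
      rw [sum_congr rfl h, sum_sub_distrib]
      congr 1
      rw [sum_ite_eq' (range (y + 1)) n]
      simp only [mem_range, show n < y + 1 ↔ y = n by omega]
    rw [sum_congr rfl key, sum_sub_distrib, stripCount]
    congr 1
    split_ifs
    · exact sum_range_choose_add x (k + 1)
    · simp

theorem sum_rowCount_total (m : ℕ) (hm : 1 ≤ m) :
    ((∑ b ∈ range (m + 2), ∑ a ∈ range (m + 1), rowCount (m + 1) m (a + 1) b : ℕ) : ℤ) =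
      2 * ∑ j ∈ Icc 1 (m + 1), ((∑ i ∈ Icc 1 (m + 1), N18 i j) +
        (((m + 1 : ℕ) : ℤ) - j - 1) * N18 j (m + 1))
      - 2 * ((2 * (m + 1)).choose (m + 1) : ℤ) + N18 (m + 1) (m + 1) + 3 := by
  push_cast
  have h : ∀ b ∈ range (m + 2), ∑ a ∈ range (m + 1), (rowCount (m + 1) m (a + 1) b : ℤ) =
      stripCount (m + 1) m (m + 1) b - (b + m).choose m -
        if b = m + 1 then ((m + 1 + m + 1).choose (m + 1) : ℤ) - 1 else 0 := by
    intro b hb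
    simp only [mem_range] at hb
    have h1 := sum_rowCount (m + 1) m (m + 1) b (by omega)
    have h2 := sum_rowCount (m + 1) m 0 b (by omega)
    rw [sum_range_succ'] at h1
    rw [stripCount_zero_left] at h2
    simp only [zero_add, sum_range_one, Nat.choose_self] at h2
    rw [h2] at h1
    split_ifs at h1 ⊢ <;> push_cast at h1 <;> linarith
  rw [sum_congr rfl h, sum_sub_distrib, sum_sub_distrib, sum_stripCount m hm,
    sum_range_choose_add (m + 1) m, sum_ite_eq' (range (m + 2)) (m + 1), if_pos (by simp),
    show 2 * (m + 1) = m + 1 + m + 1 by ring]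
  push_cast
  ring

section Walk

variable {S : Type*} [Fintype S] (R : S → S → Prop) (E : S → Prop)

open Classical in
/-- The number of `k`-step walks along `R` from `s` to a state satisfying `E`, computed by
summing over the first step. -/
noncomputable def walkCount : ℕ → S → ℕ
  | 0, s => if E s then 1 else 0
  | k + 1, s => ∑ t, if R s t then walkCount k t else 0

/-- `c` is a `k`-step walk along `R` from `s` to a state satisfying `E`. -/
def IsWalk (k : ℕ) (s : S) (c : Fin (k + 1) → S) : Prop :=
  c 0 = s ∧ (∀ i : Fin k, R (c i.castSucc) (c i.succ)) ∧ E (c (Fin.last k))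

/-- A walk with `k + 1` steps is a first step followed by a walk with `k` steps. -/
def walkSuccEquiv (k : ℕ) (s : S) : {c : Fin (k + 2) → S // IsWalk R E (k + 1) s c} ≃
    Σ t : {t // R s t}, {c : Fin (k + 1) → S // IsWalk R E k t.1 c} where
  toFun c := ⟨⟨c.1 1, by have := c.2.2.1 0; rwa [Fin.castSucc_zero, c.2.1] at this⟩,
    ⟨Fin.tail c.1, rfl, fun i => c.2.2.1 i.succ, c.2.2.2⟩⟩
  invFun p := ⟨Fin.cons s p.2.1, rfl, fun i => by
    refine Fin.cases ?_ (fun i => ?_) i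
    · have h := p.1.2
      rw [← p.2.2.1] at h
      exact h
    · exact p.2.2.2.1 i, p.2.2.2.2⟩
  left_inv c := by
    apply Subtype.ext
    have : s = c.1 0 := c.2.1.symm
    simp only [this]
    exact Fin.cons_self_tail c.1
  right_inv p := by
    obtain ⟨⟨t, ht⟩, ⟨c, h0, h⟩⟩ := p
    have ht' : c 0 = t := h0
    subst ht'
    rfl

theorem card_isWalk (k : ℕ) (s : S) :
    Nat.card {c : Fin (k + 1) → S // IsWalk R E k s c} = walkCount R E k s := by
  classical
  induction k generalizing s with
  | zero =>
    rw [walkCount]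
    split_ifs with h
    · rw [Nat.card_eq_one_iff_unique]
      refine ⟨⟨fun a b => Subtype.ext (funext fun i => ?_)⟩, ⟨⟨fun _ => s, rfl, nofun, h⟩⟩⟩
      obtain rfl : i = 0 := Fin.ext (by omega)
      rw [a.2.1, b.2.1]
    · have : IsEmpty {c : Fin 1 → S // IsWalk R E 0 s c} :=
        ⟨fun c => h (c.2.1 ▸ c.2.2.2)⟩
      exact Nat.card_of_isEmpty
  | succ k ih =>
    rw [Nat.card_congr (walkSuccEquiv R E k s), Nat.card_sigma, walkCount,
      ← Finset.sum_filter]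
    simp only [ih]
    rw [Finset.sum_subtype _ (p := fun t => R s t) (by simp)]

theorem card_walk (k : ℕ) (I : S → Prop) [DecidablePred I] :
    Nat.card {c : Fin (k + 1) → S // I (c 0) ∧ (∀ i : Fin k, R (c i.castSucc) (c i.succ)) ∧
      E (c (Fin.last k))} = ∑ s, if I s then walkCount R E k s else 0 := by
  classical
  have e : {c : Fin (k + 1) → S // I (c 0) ∧ (∀ i : Fin k, R (c i.castSucc) (c i.succ)) ∧
      E (c (Fin.last k))} ≃ Σ s : {s // I s}, {c : Fin (k + 1) → S // IsWalk R E k s.1 c} :=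
    { toFun := fun c => ⟨⟨c.1 0, c.2.1⟩, ⟨c.1, rfl, c.2.2⟩⟩
      invFun := fun p => ⟨p.2.1, by rw [p.2.2.1]; exact p.1.2, p.2.2.2⟩
      left_inv := fun c => rfl
      right_inv := by
        rintro ⟨⟨t, ht⟩, ⟨c, h0, h⟩⟩
        have ht' : c 0 = t := h0
        subst ht'
        rfl }
  rw [Nat.card_congr e, Nat.card_sigma, ← Finset.sum_filter]
  simp only [card_isWalk]
  rw [Finset.sum_subtype _ (p := fun t => I t) (by simp)]

end Walk

/-- The relation between consecutive rows of a jump-free array with `n` columns, where a row is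
encoded by its number of zeros and its number of entries `≤ 1`. -/
def RowStep (n : ℕ) (s t : Fin (n + 1) × Fin (n + 1)) : Prop :=
  (t.1 : ℕ) ≤ s.1 ∧ (t.2 : ℕ) ≤ s.2 ∧ ((s.1 : ℕ) = 0 ∨ (t.2 : ℕ) = n ∨ (s.1 : ℕ) < t.2)

theorem sum_fin_ite_le (n a : ℕ) (h : a ≤ n) (f : ℕ → ℕ) :
    ∑ i : Fin (n + 1), (if (i : ℕ) ≤ a then f i else 0) = ∑ i ∈ range (a + 1), f i := by
  rw [Fin.sum_univ_eq_sum_range (fun i => if i ≤ a then f i else 0), ← sum_filter]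
  refine sum_congr ?_ fun _ _ => rfl
  ext i
  simp only [mem_filter, mem_range]
  omega

theorem walkCount_rowStep (n k : ℕ) (s : Fin (n + 1) × Fin (n + 1)) :
    walkCount (RowStep n) (fun s => (s.2 : ℕ) < n) k s = rowCount n k s.1 s.2 := by
  induction k generalizing s with
  | zero => simp [walkCount, rowCount]
  | succ k ih =>
    obtain ⟨a, b⟩ := s
    rw [walkCount, rowCount, Fintype.sum_prod_type,
      ← sum_fin_ite_le n a (by omega)
        (fun a' => ∑ b' ∈ range ((b : ℕ) + 1),
          if (a : ℕ) = 0 ∨ b' = n ∨ (a : ℕ) < b' then rowCount n k a' b' else 0)]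
    refine sum_congr rfl fun a' _ => ?_
    rw [← sum_fin_ite_le n b (by omega)
        (fun b' => if (a : ℕ) = 0 ∨ b' = n ∨ (a : ℕ) < b' then rowCount n k a' b' else 0)]
    simp only [ih, RowStep]
    by_cases h : (a' : ℕ) ≤ a
    · simp only [h, true_and, if_true, ite_and]
    · simp only [h, false_and, if_false, sum_const_zero]

theorem card_rowSequences (m : ℕ) :
    Nat.card {c : Fin (m + 1) → Fin (m + 2) × Fin (m + 2) // (1 ≤ ((c 0).1 : ℕ)) ∧
      (∀ i : Fin m, RowStep (m + 1) (c i.castSucc) (c i.succ)) ∧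
      ((c (Fin.last m)).2 : ℕ) < m + 1} =
    ∑ b ∈ range (m + 2), ∑ a ∈ range (m + 1), rowCount (m + 1) m (a + 1) b := by
  rw [card_walk (RowStep (m + 1)) (fun s => (s.2 : ℕ) < m + 1) m (fun s => 1 ≤ (s.1 : ℕ))]
  simp only [walkCount_rowStep]
  rw [Fintype.sum_prod_type_right,
    ← Fin.sum_univ_eq_sum_range (fun b => ∑ a ∈ range (m + 1), rowCount (m + 1) m (a + 1) b)]
  refine sum_congr rfl fun b _ => ?_
  rw [Fin.sum_univ_succ, ← Fin.sum_univ_eq_sum_range (fun a => rowCount (m + 1) m (a + 1) b)]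
  simp

/-- The encodings by rows of the jump-free `(m + 1) × (m + 1)` arrays starting with `0` and
ending with `2`. -/
def IsRowSequence (m : ℕ) (c : Fin (m + 1) → Fin (m + 2) × Fin (m + 2)) : Prop :=
  (1 ≤ ((c 0).1 : ℕ)) ∧ (∀ i : Fin m, RowStep (m + 1) (c i.castSucc) (c i.succ)) ∧
    ((c (Fin.last m)).2 : ℕ) < m + 1

/-- The arrays counted by `a306322 n`. -/
def IsJumpFree (n : ℕ) (m : Fin n × Fin n → ℕ) : Prop :=
  (∀ p : Fin n × Fin n, (p.1 : ℕ) = 0 → (p.2 : ℕ) = 0 → m p = 0) ∧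
    (∀ p : Fin n × Fin n, (p.1 : ℕ) = n - 1 → (p.2 : ℕ) = n - 1 → m p = 2) ∧
    (∀ p q : Fin n × Fin n,
      ((q.1 = p.1 ∧ (q.2 : ℕ) = (p.2 : ℕ) + 1) ∨
       ((q.1 : ℕ) = (p.1 : ℕ) + 1 ∧ q.2 = p.2) ∨
       ((q.1 : ℕ) = (p.1 : ℕ) + 1 ∧ (q.2 : ℕ) = (p.2 : ℕ) + 1)) →
      m p ≤ m q ∧ m q ≤ m p + 1)

/-- The array whose `i`-th row has `(c i).1` zeros and `(c i).2` entries `≤ 1`. -/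
def toMatrix {m : ℕ} (c : Fin (m + 1) → Fin (m + 2) × Fin (m + 2))
    (p : Fin (m + 1) × Fin (m + 1)) : ℕ :=
  (if (p.2 : ℕ) < (c p.1).1 then 0 else 1) + (if (p.2 : ℕ) < (c p.1).2 then 0 else 1)

theorem IsRowSequence.admissible {m : ℕ} (hm : 1 ≤ m)
    {c : Fin (m + 1) → Fin (m + 2) × Fin (m + 2)} (hc : IsRowSequence m c) (i : Fin (m + 1)) :
    ((c i).1 : ℕ) = 0 ∨ ((c i).2 : ℕ) = m + 1 ∨ ((c i).1 : ℕ) < (c i).2 := by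
  obtain ⟨-, h, -⟩ := hc
  refine Fin.cases ?_ (fun i => ?_) i
  · have h0 := h ⟨0, hm⟩
    rw [show (⟨0, hm⟩ : Fin m).castSucc = 0 from rfl] at h0
    obtain ⟨h1, h2, h3⟩ := h0
    omega
  · obtain ⟨h1, h2, h3⟩ := h i
    omega

theorem IsRowSequence.rowStep {m : ℕ} {c : Fin (m + 1) → Fin (m + 2) × Fin (m + 2)}
    (hc : IsRowSequence m c) {i j : Fin (m + 1)} (h : (j : ℕ) = i + 1) :
    RowStep (m + 1) (c i) (c j) := by
  have h1 := hc.2.1 ⟨i, by omega⟩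
  have h2 : j = Fin.succ ⟨i, by omega⟩ := Fin.ext h
  rw [h2]
  exact h1

theorem IsRowSequence.isJumpFree_toMatrix {m : ℕ} (hm : 1 ≤ m)
    {c : Fin (m + 1) → Fin (m + 2) × Fin (m + 2)} (hc : IsRowSequence m c) :
    IsJumpFree (m + 1) (toMatrix c) := by
  refine ⟨?_, ?_, ?_⟩
  · rintro ⟨i, j⟩ hi hj
    obtain rfl : i = 0 := Fin.ext hi
    have h0 := hc.1
    have h1 := hc.admissible hm 0
    simp only [toMatrix] at *
    rw [if_pos (by omega), if_pos (by omega)]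
  · rintro ⟨i, j⟩ hi hj
    obtain rfl : i = Fin.last m := Fin.ext hi
    have h0 := hc.2.2
    have h1 := hc.admissible hm (Fin.last m)
    simp only [toMatrix] at *
    rw [if_neg (by omega), if_neg (by omega)]
  · rintro ⟨i, j⟩ ⟨i', j'⟩ h
    have hi := hc.admissible hm i
    simp only [toMatrix] at *
    obtain ⟨rfl, h⟩ | ⟨h, rfl⟩ | ⟨h, h'⟩ := h
    · split_ifs <;> omega
    · obtain ⟨h1, h2, h3⟩ := hc.rowStep h
      split_ifs <;> omega
    · obtain ⟨h1, h2, h3⟩ := hc.rowStep h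
      split_ifs <;> omega

theorem IsRowSequence.le {m : ℕ} (hm : 1 ≤ m)
    {c : Fin (m + 1) → Fin (m + 2) × Fin (m + 2)} (hc : IsRowSequence m c) (i : Fin (m + 1)) :
    ((c i).1 : ℕ) ≤ (c i).2 := by
  have := hc.admissible hm i
  omega

theorem toMatrix_injOn {m : ℕ} (hm : 1 ≤ m) {c d : Fin (m + 1) → Fin (m + 2) × Fin (m + 2)}
    (hc : IsRowSequence m c) (hd : IsRowSequence m d) (h : toMatrix c = toMatrix d) : c = d := by
  have key : ∀ a b a' b' : ℕ, a ≤ b → a' ≤ b' → a ≤ m + 1 → b ≤ m + 1 → a' ≤ m + 1 →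
      b' ≤ m + 1 → (∀ j < m + 1, (if j < a then 0 else 1) + (if j < b then 0 else 1) =
        (if j < a' then 0 else 1) + (if j < b' then 0 else 1)) → a = a' ∧ b = b' := by
    intro a b a' b' h1 h2 h3 h4 h5 h6 H
    have e (j : ℕ) (hj : j < m + 1) : (j < a ↔ j < a') ∧ (j < b ↔ j < b') := by
      have := H j hj
      split_ifs at this <;> omega
    constructor
    · by_contra hne
      rcases Nat.lt_or_gt_of_ne hne with hl | hl
      · have := e a (by omega); omega
      · have := e a' (by omega); omega
    · by_contra hne
      rcases Nat.lt_or_gt_of_ne hne with hl | hl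
      · have := e b (by omega); omega
      · have := e b' (by omega); omega
  funext i
  obtain ⟨h1, h2⟩ := key (c i).1 (c i).2 (d i).1 (d i).2 (hc.le hm i) (hd.le hm i) (by omega)
    (by omega) (by omega) (by omega) (fun j hj => congrFun h (i, ⟨j, hj⟩))
  exact Prod.ext (Fin.ext h1) (Fin.ext h2)

theorem exists_threshold (n : ℕ) (p : Fin n → Prop)
    (hp : ∀ i j : Fin n, (j : ℕ) = i + 1 → p j → p i) :
    ∃ a : Fin (n + 1), ∀ j : Fin n, (j : ℕ) < a ↔ p j := by
  induction n with
  | zero => exact ⟨0, nofun⟩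
  | succ n ih =>
    by_cases h : p (Fin.last n)
    · refine ⟨Fin.last _, fun j => ⟨fun _ => ?_, fun _ => by simp only [Fin.val_last]; omega⟩⟩
      induction j using Fin.reverseInduction with
      | last => exact h
      | cast j ihj => exact hp j.castSucc j.succ (by simp) (ihj (by simp))
    · obtain ⟨a, ha⟩ := ih (fun i => p i.castSucc) fun i j hij => hp _ _ (by simpa using hij)
      refine ⟨a.castSucc, fun j => ?_⟩
      induction j using Fin.lastCases with
      | last =>
        simp only [h, iff_false]
        simp
        omega
      | cast j => simpa using ha j

theorem IsJumpFree.le_two {m : ℕ} {M : Fin (m + 1) × Fin (m + 1) → ℕ}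
    (hM : IsJumpFree (m + 1) M) (p : Fin (m + 1) × Fin (m + 1)) : M p ≤ 2 := by
  obtain ⟨-, h2, h⟩ := hM
  have hrow (j : Fin (m + 1)) : M (Fin.last m, j) ≤ 2 := by
    induction j using Fin.reverseInduction with
    | last => exact (h2 _ rfl rfl).le
    | cast j ih => exact (h (_, j.castSucc) (_, j.succ) (Or.inl ⟨rfl, by simp⟩)).1.trans ih
  obtain ⟨i, j⟩ := p
  induction i using Fin.reverseInduction with
  | last => exact hrow j
  | cast i ih => exact (h (i.castSucc, j) (i.succ, j) (Or.inr (Or.inl ⟨by simp, rfl⟩))).1.trans ih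

theorem IsJumpFree.exists_toMatrix {m : ℕ} {M : Fin (m + 1) × Fin (m + 1) → ℕ}
    (hM : IsJumpFree (m + 1) M) : ∃ c, IsRowSequence m c ∧ toMatrix c = M := by
  have le_two := hM.le_two
  obtain ⟨h0, h2, h⟩ := hM
  have ha (i : Fin (m + 1)) : ∃ a : Fin (m + 2), ∀ j : Fin (m + 1), (j : ℕ) < a ↔ M (i, j) = 0 :=
    exists_threshold _ (fun j => M (i, j) = 0) fun j j' hj h' => by
      have := h (i, j) (i, j') (Or.inl ⟨rfl, hj⟩)
      omega
  have hb (i : Fin (m + 1)) : ∃ b : Fin (m + 2), ∀ j : Fin (m + 1), (j : ℕ) < b ↔ M (i, j) ≤ 1 :=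
    exists_threshold _ (fun j => M (i, j) ≤ 1) fun j j' hj h' => by
      have := h (i, j) (i, j') (Or.inl ⟨rfl, hj⟩)
      omega
  choose a ha using ha
  choose b hb using hb
  refine ⟨fun i => (a i, b i), ⟨?_, fun i => ⟨?_, ?_, ?_⟩, ?_⟩, ?_⟩
  · exact (ha 0 0).2 (h0 _ rfl rfl)
  · by_contra! hlt
    change (a i.castSucc : ℕ) < a i.succ at hlt
    have h1 := ha i.castSucc ⟨a i.castSucc, by omega⟩
    have h3 := ha i.succ ⟨a i.castSucc, by omega⟩
    have h4 := h (i.castSucc, ⟨a i.castSucc, by omega⟩) (i.succ, ⟨a i.castSucc, by omega⟩)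
      (Or.inr (Or.inl ⟨by simp, rfl⟩))
    simp only at h1 h3
    omega
  · by_contra! hlt
    change (b i.castSucc : ℕ) < b i.succ at hlt
    have h1 := hb i.castSucc ⟨b i.castSucc, by omega⟩
    have h3 := hb i.succ ⟨b i.castSucc, by omega⟩
    have h4 := h (i.castSucc, ⟨b i.castSucc, by omega⟩) (i.succ, ⟨b i.castSucc, by omega⟩)
      (Or.inr (Or.inl ⟨by simp, rfl⟩))
    simp only at h1 h3
    omega
  · by_contra! hlt
    change (a i.castSucc : ℕ) ≠ 0 ∧ (b i.succ : ℕ) ≠ m + 1 ∧ (b i.succ : ℕ) ≤ a i.castSucc at hlt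
    obtain ⟨hl1, hl2, hl3⟩ := hlt
    have h3 := hb i.succ ⟨b i.succ, by omega⟩
    have h1 := ha i.castSucc ⟨b i.succ - 1, by omega⟩
    have h4 : M (i.succ, ⟨b i.succ, by omega⟩) ≤ M (i.castSucc, ⟨b i.succ - 1, by omega⟩) + 1 := by
      by_cases hz : (b i.succ : ℕ) = 0
      · exact (h _ _ (Or.inr (Or.inl ⟨by simp, Fin.ext (by simp [hz])⟩))).2
      · exact (h _ _ (Or.inr (Or.inr ⟨by simp, by simp; omega⟩))).2
    simp only at h1 h3
    omega
  · have h1 := hb (Fin.last m) (Fin.last m)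
    rw [h2 _ rfl rfl] at h1
    simp at h1
    simp
    omega
  · funext ⟨i, j⟩
    have h1 := ha i j
    have h3 := hb i j
    have h4 := le_two (i, j)
    simp only [toMatrix, h1, h3]
    split_ifs <;> omega

theorem card_isJumpFree (m : ℕ) (hm : 1 ≤ m) :
    Nat.card {M : Fin (m + 1) × Fin (m + 1) → ℕ // IsJumpFree (m + 1) M} =
      ∑ b ∈ range (m + 2), ∑ a ∈ range (m + 1), rowCount (m + 1) m (a + 1) b := by
  rw [← card_rowSequences m]
  symm
  refine Nat.card_eq_of_bijective
    (fun c : {c // IsRowSequence m c} =>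
      (⟨toMatrix c.1, c.2.isJumpFree_toMatrix hm⟩ : {M // IsJumpFree (m + 1) M})) ⟨?_, ?_⟩
  · rintro ⟨c, hc⟩ ⟨d, hd⟩ h
    exact Subtype.ext (toMatrix_injOn hm hc hd (congrArg Subtype.val h))
  · rintro ⟨M, hM⟩
    obtain ⟨c, hc, rfl⟩ := hM.exists_toMatrix
    exact ⟨⟨c, hc⟩, rfl⟩

theorem card_isJumpFree_one : Nat.card {M : Fin 1 × Fin 1 → ℕ // IsJumpFree 1 M} = 0 := by
  have : IsEmpty {M : Fin 1 × Fin 1 → ℕ // IsJumpFree 1 M} := ⟨fun ⟨M, h0, h2, _⟩ => by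
    have h := h0 0 rfl rfl
    rw [h2 0 rfl rfl] at h
    omega⟩
  exact Nat.card_of_isEmpty

end Counting

/-- For every `n ≥ 1`,
`a(n) = 2·∑_{j=1}^{n} (∑_{i=1}^{n} N(i,j) + (n-j-1)·N(j,n)) - 2·C(2n,n) + N(n,n) + 3`. -/
theorem stmt18 (n : ℕ) (hn : 1 ≤ n) :
    (a306322 n : ℤ) =
      2 * ∑ j ∈ Finset.Icc 1 n,
          ((∑ i ∈ Finset.Icc 1 n, N18 i j) + ((n : ℤ) - (j : ℤ) - 1) * N18 j n)
      - 2 * ((2 * n).choose n : ℤ) + N18 n n + 3 := by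
  obtain ⟨m, rfl⟩ : ∃ m, n = m + 1 := ⟨n - 1, by omega⟩
  rcases Nat.eq_zero_or_pos m with rfl | hm
  · rw [show a306322 (0 + 1) = 0 from card_isJumpFree_one]
    simp [N18]
  · rw [show a306322 (m + 1) = _ from card_isJumpFree m hm]
    exact sum_rowCount_total m hm
end
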